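/- Let G be a simple graph on [n] with edge ideal I, and suppose index(I) = projdim(I) = t (finite). Then beta_{t,t+2}(I) = 0. -/

import Mathlib

open MvPolynomial

noncomputable section

abbrev SRing (K : Type) [Field K] (n : ℕ) := MvPolynomial (Fin n) K

/-- total degree of an exponent vector -/
def mdeg {n : ℕ} (e : Fin n →₀ ℕ) : ℕ := e.sum fun _ v => v

/-- minimal monomial generators of a monomial ideal, as exponent vectors:
monomials in `J` none of whose proper divisors lies in `J` -/
def minGen {K : Type} [Field K] {n : ℕ} (J : Ideal (SRing K n)) : Set (Fin n →₀ ℕ) :=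
  {e | (monomial e (1:K)) ∈ J ∧
    ∀ e' : Fin n →₀ ℕ, e' ≤ e → e' ≠ e → (monomial e' (1:K)) ∉ J}

/-- adjacency in the graph `G_J^{(u,v)}` : vertices are the minimal generators of `J`
dividing `lcm(u,v)`, with an edge between two of them iff their lcm has degree `d+1` -/
def lcmGraphAdj {K : Type} [Field K] {n : ℕ} (J : Ideal (SRing K n)) (d : ℕ)
    (u v : Fin n →₀ ℕ) (w w' : Fin n →₀ ℕ) : Prop :=
  w ∈ minGen J ∧ w' ∈ minGen J ∧ w ≤ u ⊔ v ∧ w' ≤ u ⊔ v ∧ mdeg (w ⊔ w') = d + 1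

/-- a graded partial free resolution of the ideal `I`, exact at homological positions `< r`:
`F_i` is free with basis in (internal) degrees `dg i`, the maps are graded of degree `0`,
`F_0` surjects onto `I`, and the sequence is exact at `F_i` for `i < r`. -/
structure GradedPartialRes {K : Type} [Field K] {n : ℕ} (I : Ideal (SRing K n)) (r : ℕ∞) where
  s : ℕ → ℕ
  dg : ∀ i, Fin (s i) → ℕ
  aug : (Fin (s 0) →₀ SRing K n) →ₗ[SRing K n] SRing K n
  diff : ∀ i, (Fin (s (i+1)) →₀ SRing K n) →ₗ[SRing K n] (Fin (s i) →₀ SRing K n)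
  aug_hom : ∀ k, (aug (Finsupp.single k 1)).IsHomogeneous (dg 0 k)
  diff_hom : ∀ i k l, (diff i (Finsupp.single k 1)) l = 0 ∨
      ∃ m, ((diff i (Finsupp.single k 1)) l).IsHomogeneous m ∧ dg i l + m = dg (i+1) k
  aug_range : LinearMap.range aug = I
  exact_zero : (0 : ℕ∞) < r → LinearMap.range (diff 0) = LinearMap.ker aug
  exact_succ : ∀ i : ℕ, ((i : ℕ∞) + 1) < r →
      LinearMap.range (diff (i+1)) = LinearMap.ker (diff i)

/-- the graded Betti number `β_{i,j}(I)`: the minimal number of degree-`j` basis elements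
in homological position `i`, over all graded partial resolutions of `I` exact at
positions `0, …, i` (the minimum is attained by the minimal graded free resolution). -/
def gradedBetti {K : Type} [Field K] {n : ℕ} (I : Ideal (SRing K n)) (i j : ℕ) : ℕ∞ :=
  ⨅ R : GradedPartialRes I ((i : ℕ∞)+1),
    ((Finset.univ.filter fun k => R.dg i k = j).card : ℕ∞)

/-- `I` (generated in degree `d`) is `r` steps linear: `β_{i,i+j}(I) = 0` for
all `i ≤ r` and `j > d` -/
def stepsLinear {K : Type} [Field K] {n : ℕ} (I : Ideal (SRing K n)) (d r : ℕ) : Prop :=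
  ∀ i ≤ r, ∀ j, d < j → gradedBetti I i (i+j) = 0

/-- `index(I) = sup{r : I is r steps linear} + 1` -/
def idealIndex {K : Type} [Field K] {n : ℕ} (I : Ideal (SRing K n)) (d : ℕ) : ℕ∞ :=
  sSup {x : ℕ∞ | ∃ r : ℕ, x = (r : ℕ∞) + 1 ∧ stepsLinear I d r}

/-- `I` is linearly related: all first syzygies are linear, i.e. `index(I) > 1` -/
def LinearlyRelated {K : Type} [Field K] {n : ℕ} (I : Ideal (SRing K n)) (d : ℕ) : Prop :=
  stepsLinear I d 1

/-- projective dimension of `I`: the minimal length of a graded free resolution of `I` -/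
def projDim {K : Type} [Field K] {n : ℕ} (I : Ideal (SRing K n)) : ℕ∞ :=
  sInf {x : ℕ∞ | ∃ m : ℕ, x = (m : ℕ∞) ∧
    ∃ R : GradedPartialRes I ⊤, ∀ i : ℕ, m < i → R.s i = 0}

/-- the edge ideal of the graph (possibly with loops) given by a symmetric relation `E`:
generated by the monomials `X i * X j` with `E i j` -/
def edgeIdeal (K : Type) [Field K] {n : ℕ} (E : Fin n → Fin n → Prop) : Ideal (SRing K n) :=
  Ideal.span {p | ∃ i j, E i j ∧ p = X i * X j}

/-- `E` is gap free: for any two disjoint edges there is an edge meeting both -/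
def GapFree {n : ℕ} (E : Fin n → Fin n → Prop) : Prop :=
  ∀ i i' j j', E i i' → E j j' → i ≠ j → i ≠ j' → i' ≠ j → i' ≠ j' →
    ∃ a b, E a b ∧ (a = i ∨ a = i') ∧ (b = j ∨ b = j')

section Signs

variable {n : ℕ}

/-- The sign `(-1) ^ #{u ∈ A | u < v}` of inserting `v` into `A`. -/
def insSign (v : Fin n) (A : Finset (Fin n)) : ℤ := (-1) ^ (A.filter (· < v)).card

theorem insSign_mul_self (v : Fin n) (A : Finset (Fin n)) : insSign v A * insSign v A = 1 := by
  unfold insSign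
  rw [← mul_pow]; simp

theorem insSign_insert (v u : Fin n) (A : Finset (Fin n)) (hu : u ∉ A) :
    insSign v (insert u A) = (if u < v then -1 else 1) * insSign v A := by
  unfold insSign
  rw [Finset.filter_insert]
  split_ifs with h
  · rw [Finset.card_insert_of_notMem (by simp [hu]), pow_succ]; ring
  · simp

theorem insSign_anticomm (u v : Fin n) (A : Finset (Fin n)) (hu : u ∉ A) (hv : v ∉ A)
    (huv : u ≠ v) :
    insSign v A * insSign u (insert v A) = -(insSign u A * insSign v (insert u A)) := by
  rw [insSign_insert _ _ _ hv, insSign_insert _ _ _ hu]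
  rcases lt_or_gt_of_ne huv with h | h
  · simp [h, h.not_gt]; ring
  · simp [h, h.not_gt]; ring

/-- A double sum of an antisymmetric function over ordered pairs of distinct elements vanishes,
in any characteristic. -/
theorem sum_erase_antisymm {ι M : Type*} [DecidableEq ι] [AddCommGroup M] (T : Finset ι)
    (F : ι → ι → M) (hF : ∀ u ∈ T, ∀ v ∈ T, u ≠ v → F u v = -F v u) :
    ∑ v ∈ T, ∑ u ∈ T.erase v, F v u = 0 := by
  rw [Finset.sum_sigma']
  refine Finset.sum_involution (fun x _ => ⟨x.2, x.1⟩) ?_ ?_ ?_ ?_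
  · rintro ⟨v, u⟩ h
    simp only [Finset.mem_sigma, Finset.mem_erase] at h
    simp only
    rw [hF v h.1 u h.2.2 (Ne.symm h.2.1)]; simp
  · rintro ⟨v, u⟩ h _ heq
    simp only [Finset.mem_sigma, Finset.mem_erase] at h
    simp only [Sigma.mk.injEq, heq_eq_eq] at heq
    exact h.2.1 heq.1
  · rintro ⟨v, u⟩ h
    simp only [Finset.mem_sigma, Finset.mem_erase] at h ⊢
    exact ⟨h.2.2, Ne.symm h.2.1, h.1⟩
  · rintro ⟨v, u⟩ h
    rfl

end Signs

section Koszul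

variable {K : Type} [Field K] {n : ℕ} {M N : Type} [AddCommGroup M] [Module (SRing K n) M]
  [AddCommGroup N] [Module (SRing K n) N]

variable (K) in
/-- The differential of the Koszul complex of the variables with coefficients in `M`; an element
of the complex is the family of its coefficients, indexed by subsets of the variables. -/
def koszulD (f : Finset (Fin n) → M) (A : Finset (Fin n)) : M :=
  ∑ v ∈ Aᶜ, insSign v A • (X v : SRing K n) • f (insert v A)

theorem koszulD_map (φ : M →ₗ[SRing K n] N) (f : Finset (Fin n) → M) (A : Finset (Fin n)) :
    koszulD K (fun B => φ (f B)) A = φ (koszulD K f A) := by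
  simp only [koszulD, map_sum, map_zsmul, map_smul]

theorem koszulD_sub (f g : Finset (Fin n) → M) (A : Finset (Fin n)) :
    koszulD K (fun B => f B - g B) A = koszulD K f A - koszulD K g A := by
  simp only [koszulD, smul_sub, Finset.sum_sub_distrib]

theorem koszulD_koszulD (f : Finset (Fin n) → M) (A : Finset (Fin n)) :
    koszulD K (koszulD K f) A = 0 := by
  have h : koszulD K (koszulD K f) A = ∑ v ∈ Aᶜ, ∑ u ∈ Aᶜ.erase v,
      (insSign v A * insSign u (insert v A)) • ((X v * X u : SRing K n)) •
        f (insert u (insert v A)) := by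
    simp only [koszulD, Finset.smul_sum]
    refine Finset.sum_congr rfl fun v _ => ?_
    rw [show (insert v A)ᶜ = Aᶜ.erase v by ext; simp]
    refine Finset.sum_congr rfl fun u _ => ?_
    rw [mul_smul, mul_smul, smul_comm (X v : SRing K n) (insSign u (insert v A))]
  rw [h]
  refine sum_erase_antisymm _ _ fun u hu v hv huv => ?_
  rw [insSign_anticomm v u A (by simpa using hv) (by simpa using hu) huv.symm, neg_smul,
    mul_comm (X u : SRing K n), Finset.insert_comm]

theorem koszulD_eq_zero {f : Finset (Fin n) → M} {i : ℕ} (hf : ∀ A, A.card ≠ i + 1 → f A = 0)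
    {A : Finset (Fin n)} (hA : A.card ≠ i) : koszulD K f A = 0 := by
  refine Finset.sum_eq_zero fun v hv => ?_
  rw [hf, smul_zero, smul_zero]
  rw [Finset.card_insert_of_notMem (by simpa using hv)]
  omega

theorem koszulD_congr {f g : Finset (Fin n) → M} {i : ℕ} (h : ∀ A, A.card = i + 1 → f A = g A)
    {A : Finset (Fin n)} (hA : A.card = i) : koszulD K f A = koszulD K g A := by
  refine Finset.sum_congr rfl fun v hv => ?_
  rw [h]
  rw [Finset.card_insert_of_notMem (by simpa using hv), hA]

end Koszul

section Multidegree

variable {K : Type} [Field K] {n : ℕ}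

/-- The exponent vector of the squarefree monomial `∏ v ∈ A, X v`. -/
def sqfreeExp (A : Finset (Fin n)) : Fin n →₀ ℕ := Finsupp.indicator A fun _ _ => 1

theorem sqfreeExp_apply (A : Finset (Fin n)) (v : Fin n) :
    sqfreeExp A v = if v ∈ A then 1 else 0 := by
  simp [sqfreeExp, Finsupp.indicator_apply]

theorem sqfreeExp_le {A : Finset (Fin n)} {α : Fin n →₀ ℕ} (h : A ⊆ α.support) :
    sqfreeExp A ≤ α := by
  intro v
  rw [sqfreeExp_apply]
  split_ifs with hv
  · have := Finsupp.mem_support_iff.1 (h hv); omega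
  · exact Nat.zero_le _

/-- The coefficients of a Koszul chain in the multidegree `α`. -/
def multiCoeff (α : Fin n →₀ ℕ) (f : Finset (Fin n) → SRing K n) (A : Finset (Fin n)) : K :=
  coeff (α - sqfreeExp A) (f A)

/-- The Koszul differential of the polynomial ring in the multidegree `α`. -/
def multiD (α : Fin n →₀ ℕ) (c : Finset (Fin n) → K) (A : Finset (Fin n)) : K :=
  ∑ v ∈ α.support \ A, insSign v A • c (insert v A)

theorem multiCoeff_koszulD (α : Fin n →₀ ℕ) (f : Finset (Fin n) → SRing K n)
    (A : Finset (Fin n)) :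
    multiCoeff α (koszulD K f) A = multiD α (multiCoeff α f) A := by
  have hl : ∀ e (p : SRing K n), coeff e p = lcoeff K e p := fun _ _ => rfl
  simp only [multiCoeff, koszulD, multiD]
  have hz : ∀ e (z : ℤ) (p : SRing K n), coeff e (z • p) = z • coeff e p := fun e z p => by
    simp only [hl, map_zsmul]
  rw [hl, map_sum]
  simp only [← hl, hz, smul_eq_mul]
  have hsub : α.support \ A ⊆ Aᶜ := by
    intro v hv; simp only [Finset.mem_sdiff] at hv; simpa using hv.2
  symm
  rw [← Finset.sum_subset hsub]
  · refine Finset.sum_congr rfl fun v hv => ?_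
    simp only [Finset.mem_sdiff] at hv
    rw [coeff_X_mul', if_pos]
    · congr 2
      ext u
      simp only [Finsupp.tsub_apply, sqfreeExp_apply, Finset.mem_insert, Finsupp.single_apply]
      by_cases huv : u = v
      · subst huv; simp [hv.2]
      · simp [huv, Ne.symm huv]
    · have := hv.1
      rw [Finsupp.mem_support_iff] at this ⊢
      simpa [sqfreeExp_apply, hv.2] using this
  · intro v hv hv'
    simp only [Finset.mem_sdiff, not_and, not_not] at hv'
    have hvA : v ∉ A := by simpa using hv
    have : v ∉ α.support := fun h => hvA (hv' h)
    rw [coeff_X_mul', if_neg, smul_zero]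
    rw [Finsupp.mem_support_iff] at this ⊢
    simpa [sqfreeExp_apply, hvA] using this

theorem tsub_sqfreeExp_injective {α β : Fin n →₀ ℕ} {A : Finset (Fin n)} (hα : A ⊆ α.support)
    (hβ : A ⊆ β.support) (h : α - sqfreeExp A = β - sqfreeExp A) : α = β := by
  rw [← tsub_add_cancel_of_le (sqfreeExp_le hα), h, tsub_add_cancel_of_le (sqfreeExp_le hβ)]

theorem support_add_sqfreeExp (e : Fin n →₀ ℕ) (A : Finset (Fin n)) :
    A ⊆ (e + sqfreeExp A).support := by
  intro v hv
  simp [Finsupp.mem_support_iff, sqfreeExp_apply, hv]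

/-- Multigraded pieces of a Koszul chain can be prescribed on a finite set of multidegrees. -/
theorem exists_multiCoeff_eq (T : Finset (Fin n →₀ ℕ))
    (c : (Fin n →₀ ℕ) → Finset (Fin n) → K) :
    ∃ g : Finset (Fin n) → SRing K n, ∀ (β : Fin n →₀ ℕ) (A : Finset (Fin n)),
      A ⊆ β.support → multiCoeff β g A = if β ∈ T then c β A else 0 := by
  refine ⟨fun A => ∑ α ∈ T, if A ⊆ α.support then monomial (α - sqfreeExp A) (c α A) else 0,
    fun β A hA => ?_⟩
  rw [multiCoeff, coeff_sum]
  have h : ∀ α ∈ T, coeff (β - sqfreeExp A)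
      (if A ⊆ α.support then monomial (α - sqfreeExp A) (c α A) else 0) =
      if β = α then c β A else 0 := by
    intro α _
    split_ifs with h1 h2 h2
    · subst h2; simp
    · rw [coeff_monomial, if_neg]
      exact fun h => h2 (tsub_sqfreeExp_injective h1 hA h).symm
    · subst h2; exact absurd hA h1
    · simp
  rw [Finset.sum_congr rfl h, Finset.sum_ite_eq]

/-- A Koszul chain is a boundary up to monomials outside `face` as soon as this holds in each
multidegree. -/
theorem exists_koszulD_of_multiD (f : Finset (Fin n) → SRing K n)
    (face : Finset (Fin n) → (Fin n →₀ ℕ) → Prop)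
    (h : ∀ β, ∃ c : Finset (Fin n) → K, ∀ A ⊆ β.support, face A (β - sqfreeExp A) →
      multiCoeff β f A = multiD β c A) :
    ∃ g : Finset (Fin n) → SRing K n, ∀ A e, face A e →
      coeff e (f A) = coeff e (koszulD K g A) := by
  choose c hc using h
  let T : Finset (Fin n →₀ ℕ) :=
    Finset.univ.biUnion fun A => (f A).support.image (· + sqfreeExp A)
  obtain ⟨g, hg⟩ := exists_multiCoeff_eq T c
  refine ⟨g, fun A e he => ?_⟩
  set β := e + sqfreeExp A with hβ
  have hA : A ⊆ β.support := support_add_sqfreeExp e A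
  have heβ : e = β - sqfreeExp A := by rw [hβ, add_tsub_cancel_right]
  have hgoal : multiCoeff β f A = multiCoeff β (koszulD K g) A := by
    rw [multiCoeff_koszulD]
    have hins : ∀ v ∈ β.support \ A, insert v A ⊆ β.support := fun v hv =>
      Finset.insert_subset (Finset.mem_sdiff.1 hv).1 hA
    by_cases hT : β ∈ T
    · rw [hc β A hA (heβ ▸ he)]
      refine Finset.sum_congr rfl fun v hv => ?_
      rw [hg β _ (hins v hv), if_pos hT]
    · have hz : multiD β (multiCoeff β g) A = 0 := by
        refine Finset.sum_eq_zero fun v hv => ?_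
        rw [hg β _ (hins v hv), if_neg hT, smul_zero]
      rw [hz]
      by_contra hne
      refine hT ?_
      simp only [T, Finset.mem_biUnion, Finset.mem_univ, true_and, Finset.mem_image]
      refine ⟨A, e, ?_, rfl⟩
      rw [mem_support_iff, heβ]
      exact hne
  rw [heβ]
  exact hgoal

/-- The cone construction with apex `v` contracts the complex in multidegree `α`. -/
theorem exists_multiD_of_cone (α : Fin n →₀ ℕ) (v : Fin n) (hv : v ∈ α.support)
    (c : Finset (Fin n) → K) :
    ∃ b : Finset (Fin n) → K, ∀ A ⊆ α.support,
      (v ∈ A → multiD α c (A.erase v) = 0) → c A = multiD α b A := by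
  refine ⟨fun A => if v ∈ A then insSign v (A.erase v) • c (A.erase v) else 0, fun A hA h => ?_⟩
  by_cases hvA : v ∈ A
  · obtain ⟨B, hvB, rfl⟩ : ∃ B, v ∉ B ∧ A = insert v B :=
      ⟨A.erase v, by simp, (Finset.insert_erase hvA).symm⟩
    have h := h hvA
    rw [Finset.erase_insert hvB] at h
    simp only [multiD] at h ⊢
    have hs : α.support \ B = insert v (α.support \ insert v B) := by
      ext u
      simp only [Finset.mem_sdiff, Finset.mem_insert, not_or]
      by_cases huv : u = v
      · subst huv; simp_all
      · simp [huv]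
    rw [hs, Finset.sum_insert (by simp)] at h
    have h' := congrArg (insSign v B • ·) h
    simp only [smul_add, smul_smul, insSign_mul_self, one_smul, smul_zero, Finset.smul_sum] at h'
    rw [eq_neg_of_add_eq_zero_left h', ← Finset.sum_neg_distrib]
    refine Finset.sum_congr rfl fun u hu => ?_
    simp only [Finset.mem_sdiff, Finset.mem_insert, not_or] at hu
    rw [if_pos (by simp), Finset.insert_comm, Finset.erase_insert (by simp [hvB, Ne.symm hu.2.1]),
      smul_smul, ← neg_smul]
    congr 1
    have h1 := insSign_anticomm u v B hu.2.2 hvB hu.2.1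
    have h2 := insSign_mul_self v B
    have h3 := insSign_mul_self v (insert u B)
    linear_combination -(insSign v B * insSign v (insert u B)) * h1 +
      insSign u (insert v B) * insSign v (insert u B) * h2 + insSign u B * insSign v B * h3
  · rw [multiD, Finset.sum_eq_single v]
    · rw [if_pos (by simp), Finset.erase_insert hvA, smul_smul, insSign_mul_self, one_smul]
    · intro u _ huv
      rw [if_neg (by simp [hvA, Ne.symm huv]), smul_zero]
    · intro h; exact absurd (Finset.mem_sdiff.2 ⟨hv, hvA⟩) h

/-- The Koszul complex of the polynomial ring is exact away from the constants in degree zero. -/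
theorem exists_koszulD_eq (f : Finset (Fin n) → SRing K n) (hf : ∀ A, koszulD K f A = 0)
    (h0 : coeff 0 (f ∅) = 0) : ∃ g, ∀ A, f A = koszulD K g A := by
  obtain ⟨g, hg⟩ := exists_koszulD_of_multiD f (fun _ _ => True) fun β => by
    by_cases hβ : β = 0
    · refine ⟨0, fun A hA _ => ?_⟩
      subst hβ
      have : A = ∅ := by simpa using hA
      subst this
      simpa [multiCoeff, multiD] using h0
    · obtain ⟨v, hv⟩ := Finsupp.support_nonempty_iff.2 hβ
      obtain ⟨b, hb⟩ := exists_multiD_of_cone β v hv (multiCoeff β f)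
      refine ⟨b, fun A hA _ => hb A hA fun _ => ?_⟩
      rw [← multiCoeff_koszulD, multiCoeff, hf, coeff_zero]
  exact ⟨g, fun A => MvPolynomial.ext _ _ fun e => hg A e trivial⟩

theorem exists_koszulD_eq_finsupp {ι : Type} [Finite ι]
    (f : Finset (Fin n) → (ι →₀ SRing K n)) (hf : ∀ A, koszulD K f A = 0)
    (h0 : ∀ l, coeff 0 (f ∅ l) = 0) : ∃ g, ∀ A, f A = koszulD K g A := by
  have h : ∀ l, ∃ g : Finset (Fin n) → SRing K n, ∀ A, f A l = koszulD K g A := fun l => by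
    refine exists_koszulD_eq (fun A => f A l) (fun A => ?_) (h0 l)
    have := koszulD_map (K := K) (Finsupp.lapply (M := SRing K n) (R := SRing K n) l) f A
    simp only [Finsupp.lapply_apply] at this
    rw [this, hf, Finsupp.zero_apply]
  choose g hg using h
  refine ⟨fun A => Finsupp.equivFunOnFinite.symm fun l => g l A, fun A => ?_⟩
  ext1 l
  have := koszulD_map (K := K) (Finsupp.lapply (M := SRing K n) (R := SRing K n) l)
    (fun A => Finsupp.equivFunOnFinite.symm fun l => g l A) A
  simp only [Finsupp.lapply_apply] at this
  rw [← this, hg]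
  rfl

end Multidegree

section GradedFree

variable {K : Type} [Field K] {n : ℕ} {ι κ : Type}

/-- Homogeneity of degree `j` in the free module whose `l`-th basis vector has degree `w l`. -/
def HomDeg (w : ι → ℕ) (j : ℕ) (f : ι →₀ SRing K n) : Prop :=
  ∀ l e, coeff e (f l) ≠ 0 → e.degree + w l = j

theorem finsupp_ext_coeff {f g : ι →₀ SRing K n} (h : ∀ l e, coeff e (f l) = coeff e (g l)) :
    f = g :=
  Finsupp.ext fun l => MvPolynomial.ext _ _ fun e => h l e

theorem HomDeg.monomial_smul {w : ι → ℕ} {j : ℕ} {f : ι →₀ SRing K n} (hf : HomDeg w j f)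
    (e : Fin n →₀ ℕ) (a : K) : HomDeg w (e.degree + j) ((monomial e a : SRing K n) • f) := by
  intro l e' h
  rw [Finsupp.smul_apply, smul_eq_mul, coeff_monomial_mul'] at h
  split_ifs at h with hle
  · have h2 := hf l (e' - e) (right_ne_zero_of_mul h)
    have : e'.degree = e.degree + (e' - e).degree := by
      rw [← map_add, add_tsub_cancel_of_le hle]
    omega
  · exact absurd rfl h

theorem homDeg_single (w : ι → ℕ) (k : ι) :
    HomDeg w (w k) (Finsupp.single k (1 : SRing K n)) := by
  classical
  intro l e h
  rw [Finsupp.single_apply] at h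
  split_ifs at h with hk
  · subst hk
    rw [coeff_one] at h
    split_ifs at h with he
    · subst he; simp
    · exact absurd rfl h
  · simp at h

/-- Vanishing of the `i`-th Koszul homology in degree `j` of the quotient of a graded free module
by the submodule `Z`. -/
def KoszulVanish (w : ι → ℕ) (Z : Submodule (SRing K n) (ι →₀ SRing K n)) (i j : ℕ) : Prop :=
  ∀ f : Finset (Fin n) → (ι →₀ SRing K n), (∀ A, A.card ≠ i → f A = 0) →
    (∀ A, HomDeg (fun l => w l + A.card) j (f A)) → (∀ A, koszulD K f A ∈ Z) →
    ∃ g, ∀ A, A.card = i → f A - koszulD K g A ∈ Z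

theorem KoszulVanish.no_generator {w : ι → ℕ} {Z : Submodule (SRing K n) (ι →₀ SRing K n)}
    (hmin : ∀ x ∈ Z, ∀ l, coeff 0 (x l) = 0) {j : ℕ} (h : KoszulVanish w Z 0 j) (l : ι) :
    w l ≠ j := by
  rintro rfl
  let f : Finset (Fin n) → (ι →₀ SRing K n) := fun A => if A.card = 0 then Finsupp.single l 1 else 0
  obtain ⟨g, hg⟩ := h f (fun A hA => if_neg hA)
    (fun A => by
      simp only [f]
      split_ifs with hA
      · simpa [hA] using homDeg_single (K := K) (n := n) w l
      · intro l e hne; simp at hne)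
    (fun A => by
      rw [koszulD, Finset.sum_eq_zero]
      · exact Z.zero_mem
      · intro v hv
        simp only [f]
        rw [if_neg (by simp), smul_zero, smul_zero])
  have h1 := hmin _ (hg ∅ rfl) l
  rw [Finsupp.sub_apply, coeff_sub, sub_eq_zero] at h1
  have h2 : coeff 0 (koszulD K g ∅ l) = 0 := by
    have h3 := koszulD_map (K := K) (Finsupp.lapply (M := SRing K n) (R := SRing K n) l) g ∅
    simp only [Finsupp.lapply_apply] at h3
    rw [← h3]
    have h4 := multiCoeff_koszulD (0 : Fin n →₀ ℕ) (fun A => g A l) ∅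
    simpa [multiCoeff, multiD] using h4
  rw [h2] at h1
  simp [f] at h1

variable [Finite ι] [Finite κ]

/-- The component of degree `j` in the free module whose `l`-th basis vector has degree `w l`. -/
def homPart (w : ι → ℕ) (j : ℕ) (f : ι →₀ SRing K n) : ι →₀ SRing K n :=
  Finsupp.equivFunOnFinite.symm fun l =>
    if w l ≤ j then homogeneousComponent (j - w l) (f l) else 0

theorem coeff_homPart (w : ι → ℕ) (j : ℕ) (f : ι →₀ SRing K n) (l : ι) (e : Fin n →₀ ℕ) :
    coeff e (homPart w j f l) = if e.degree + w l = j then coeff e (f l) else 0 := by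
  simp only [homPart, Finsupp.equivFunOnFinite_symm_apply_apply]
  split_ifs with h1 h2 h2
  · rw [coeff_homogeneousComponent, if_pos (by omega)]
  · rw [coeff_homogeneousComponent, if_neg (by omega)]
  · omega
  · simp

theorem homDeg_homPart (w : ι → ℕ) (j : ℕ) (f : ι →₀ SRing K n) :
    HomDeg w j (homPart w j f) := by
  intro l e h
  rw [coeff_homPart] at h
  by_contra h'
  exact h (if_neg h')

theorem HomDeg.homPart_eq {w : ι → ℕ} {j : ℕ} {f : ι →₀ SRing K n} (hf : HomDeg w j f) :
    homPart w j f = f := by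
  refine finsupp_ext_coeff fun l e => ?_
  rw [coeff_homPart]
  split_ifs with h
  · rfl
  · by_contra h'
    exact h (hf l e (Ne.symm h'))

theorem HomDeg.homPart_eq_zero {w : ι → ℕ} {j k : ℕ} {f : ι →₀ SRing K n} (hf : HomDeg w j f)
    (hjk : j ≠ k) : homPart w k f = 0 := by
  refine finsupp_ext_coeff fun l e => ?_
  rw [coeff_homPart]
  split_ifs with h
  · by_contra h'
    exact hjk ((hf l e (by simpa using h')).symm.trans h)
  · simp

theorem HomDeg.homPart_eq_ite {w : ι → ℕ} {j : ℕ} {f : ι →₀ SRing K n} (hf : HomDeg w j f)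
    (k : ℕ) : homPart w k f = if j = k then f else 0 := by
  split_ifs with h
  · subst h; exact hf.homPart_eq
  · exact hf.homPart_eq_zero h

theorem homPart_add (w : ι → ℕ) (j : ℕ) (f g : ι →₀ SRing K n) :
    homPart w j (f + g) = homPart w j f + homPart w j g := by
  refine finsupp_ext_coeff fun l e => ?_
  simp only [Finsupp.add_apply, coeff_add, coeff_homPart]
  split_ifs <;> simp

theorem homPart_zero (w : ι → ℕ) (j : ℕ) : homPart w j (0 : ι →₀ SRing K n) = 0 := by
  refine finsupp_ext_coeff fun l e => ?_
  simp [coeff_homPart]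

/-- The map of free modules sends basis vectors to homogeneous elements of the same degree. -/
def IsGradedMap (w' : κ → ℕ) (w : ι → ℕ) (φ : (κ →₀ SRing K n) →ₗ[SRing K n] (ι →₀ SRing K n)) :
    Prop :=
  ∀ k, HomDeg w (w' k) (φ (Finsupp.single k 1))

theorem IsGradedMap.map_homPart {w' : κ → ℕ} {w : ι → ℕ}
    {φ : (κ →₀ SRing K n) →ₗ[SRing K n] (ι →₀ SRing K n)} (hφ : IsGradedMap w' w φ) (j : ℕ)
    (f : κ →₀ SRing K n) : φ (homPart w' j f) = homPart w j (φ f) := by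
  induction f using Finsupp.induction_linear with
  | zero => simp only [homPart_zero, map_zero]
  | add f g hf hg => rw [homPart_add, map_add, hf, hg, map_add, homPart_add]
  | single k p =>
    induction p using MvPolynomial.induction_on' with
    | add p q hp hq =>
      rw [Finsupp.single_add, homPart_add, map_add, hp, hq, map_add, homPart_add]
    | monomial e a =>
      have hs : Finsupp.single k (monomial e a) =
          (monomial e a : SRing K n) • Finsupp.single k (1 : SRing K n) := by
        rw [Finsupp.smul_single, smul_eq_mul, mul_one]
      rw [hs, ((homDeg_single w' k).monomial_smul e a).homPart_eq_ite, map_smul,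
        ((hφ k).monomial_smul e a).homPart_eq_ite]
      split_ifs
      · rw [map_smul]
      · rw [map_zero]

theorem homPart_X_smul (w : ι → ℕ) (j : ℕ) (v : Fin n) (f : ι →₀ SRing K n) :
    homPart w j ((X v : SRing K n) • f) =
      (X v : SRing K n) • homPart (fun l => w l + 1) j f := by
  have h : IsGradedMap (fun l => w l + 1) w
      (LinearMap.lsmul (SRing K n) (ι →₀ SRing K n) (X v)) := by
    intro k
    have := (homDeg_single (K := K) (n := n) w k).monomial_smul (Finsupp.single v 1) 1
    rw [LinearMap.lsmul_apply]
    simpa [Finsupp.degree_single, add_comm, X] using this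
  exact (h.map_homPart j f).symm

/-- The part of total degree `j` of a Koszul chain with coefficients in a graded free module. -/
def koszulHomPart (w : ι → ℕ) (j : ℕ) (f : Finset (Fin n) → (ι →₀ SRing K n))
    (A : Finset (Fin n)) : ι →₀ SRing K n :=
  homPart (fun l => w l + A.card) j (f A)

theorem homPart_zsmul_insSign (w : ι → ℕ) (j : ℕ) (v : Fin n) (A : Finset (Fin n))
    (f : ι →₀ SRing K n) : homPart w j (insSign v A • f) = insSign v A • homPart w j f := by
  let φ : (ι →₀ SRing K n) →+ (ι →₀ SRing K n) :=
    { toFun := homPart w j, map_zero' := homPart_zero w j, map_add' := homPart_add w j }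
  exact map_zsmul φ _ _

theorem homPart_sum {τ : Type} (w : ι → ℕ) (j : ℕ) (s : Finset τ) (f : τ → (ι →₀ SRing K n)) :
    homPart w j (∑ i ∈ s, f i) = ∑ i ∈ s, homPart w j (f i) := by
  let φ : (ι →₀ SRing K n) →+ (ι →₀ SRing K n) :=
    { toFun := homPart w j, map_zero' := homPart_zero w j, map_add' := homPart_add w j }
  exact map_sum φ _ _

theorem koszulD_koszulHomPart (w : ι → ℕ) (j : ℕ) (f : Finset (Fin n) → (ι →₀ SRing K n))
    (A : Finset (Fin n)) :
    koszulD K (koszulHomPart w j f) A = koszulHomPart w j (koszulD K f) A := by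
  simp only [koszulD, koszulHomPart, homPart_sum, homPart_zsmul_insSign, homPart_X_smul]
  refine Finset.sum_congr rfl fun v hv => ?_
  rw [Finset.card_insert_of_notMem (by simpa using hv)]
  simp only [add_assoc]

theorem koszulVanish_of_no_generator {w : ι → ℕ} {Z : Submodule (SRing K n) (ι →₀ SRing K n)}
    {j : ℕ} (h : ∀ l, w l ≠ j) : KoszulVanish w Z 0 j := by
  intro f hf hdeg _
  have hd : ∀ A, koszulD K f A = 0 := fun A => by
    refine Finset.sum_eq_zero fun v hv => ?_
    rw [hf _ (by simp), smul_zero, smul_zero]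
  have h0 : ∀ l, coeff 0 (f ∅ l) = 0 := fun l => by
    by_contra hne
    have := hdeg ∅ l 0 hne
    exact h l (by simpa using this)
  obtain ⟨g, hg⟩ := exists_koszulD_eq_finsupp f hd h0
  refine ⟨g, fun A _ => ?_⟩
  rw [hg, sub_self]
  exact Z.zero_mem

theorem KoszulVanish.of_syzygy {w' : κ → ℕ} {w : ι → ℕ}
    {Z : Submodule (SRing K n) (ι →₀ SRing K n)}
    {φ : (κ →₀ SRing K n) →ₗ[SRing K n] (ι →₀ SRing K n)} (hφ : IsGradedMap w' w φ)
    (hZ : LinearMap.range φ = Z) {i j : ℕ} (h : KoszulVanish w' (LinearMap.ker φ) i j) :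
    KoszulVanish w Z (i + 1) j := by
  intro f hf hdeg hd
  have hlift : ∀ A, ∃ x, φ x = koszulD K f A := fun A => by
    have := hd A
    rw [← hZ] at this
    exact this
  choose g₀ hg₀ using hlift
  have hfhom : koszulHomPart w j f = f := funext fun A => (hdeg A).homPart_eq
  let g : Finset (Fin n) → (κ →₀ SRing K n) := fun A =>
    if A.card = i then koszulHomPart w' j g₀ A else 0
  have hg : ∀ A, φ (g A) = koszulD K f A := by
    intro A
    simp only [g]
    split_ifs with hA
    · have hgr : IsGradedMap (fun l => w' l + A.card) (fun l => w l + A.card) φ := by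
        intro k l e hne
        have := hφ k l e hne
        simp only
        omega
      rw [koszulHomPart, hgr.map_homPart, hg₀]
      change koszulHomPart w j (koszulD K f) A = _
      rw [← koszulD_koszulHomPart, hfhom]
    · rw [map_zero, koszulD_eq_zero hf hA]
  obtain ⟨k, hk⟩ := h g (fun A hA => if_neg hA)
    (fun A => by
      simp only [g]
      split_ifs
      · exact homDeg_homPart _ _ _
      · intro l e hne; simp at hne)
    (fun A => by
      rw [LinearMap.mem_ker, ← koszulD_map]
      simp only [hg, koszulD_koszulD])
  let k' : Finset (Fin n) → (κ →₀ SRing K n) := fun A => if A.card = i + 1 then k A else 0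
  have hk' : ∀ A, koszulD K (fun B => φ (k' B)) A = koszulD K f A := by
    intro A
    by_cases hA : A.card = i
    · rw [koszulD_map, koszulD_congr (g := k) (fun B hB => if_pos hB) hA]
      have := hk A hA
      rw [LinearMap.mem_ker, map_sub, sub_eq_zero, hg] at this
      exact this.symm
    · rw [koszulD_eq_zero hf hA, koszulD_eq_zero (i := i) _ hA]
      intro B hB
      simp only [k', if_neg hB, map_zero]
  obtain ⟨m, hm⟩ := exists_koszulD_eq_finsupp (fun A => f A - φ (k' A))
    (fun A => by rw [koszulD_sub, hk', sub_self])
    (fun l => by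
      rw [hf ∅ (by simp)]
      have : k' ∅ = 0 := if_neg (by simp)
      simp [this])
  refine ⟨m, fun A _ => ?_⟩
  rw [← hm A, sub_sub_cancel, ← hZ]
  exact ⟨_, rfl⟩

theorem KoszulVanish.syzygy {w' : κ → ℕ} {w : ι → ℕ}
    {Z : Submodule (SRing K n) (ι →₀ SRing K n)}
    {φ : (κ →₀ SRing K n) →ₗ[SRing K n] (ι →₀ SRing K n)} (hφ : IsGradedMap w' w φ)
    (hZ : LinearMap.range φ = Z) (hmin : ∀ x ∈ Z, ∀ l, coeff 0 (x l) = 0) {i j : ℕ}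
    (h : KoszulVanish w Z (i + 1) j) : KoszulVanish w' (LinearMap.ker φ) i j := by
  intro g hg hdeg hd
  have hmem : ∀ x, φ x ∈ Z := fun x => hZ ▸ ⟨x, rfl⟩
  have hdφ : ∀ A, koszulD K (fun B => φ (g B)) A = 0 := fun A => by
    rw [koszulD_map]; exact hd A
  obtain ⟨f₀, hf₀⟩ := exists_koszulD_eq_finsupp (fun A => φ (g A)) hdφ
    (fun l => hmin _ (hmem _) l)
  let f : Finset (Fin n) → (ι →₀ SRing K n) := fun A =>
    if A.card = i + 1 then koszulHomPart w j f₀ A else 0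
  have hf : ∀ A, koszulD K f A = φ (g A) := by
    intro A
    by_cases hA : A.card = i
    · rw [koszulD_congr (g := koszulHomPart w j f₀) (fun B hB => if_pos hB) hA,
        koszulD_koszulHomPart, koszulHomPart, ← hf₀]
      have hgr : IsGradedMap (fun l => w' l + A.card) (fun l => w l + A.card) φ := by
        intro k l e hne
        have := hφ k l e hne
        simp only
        omega
      rw [← hgr.map_homPart, (hdeg A).homPart_eq]
    · rw [koszulD_eq_zero (i := i) (fun B hB => if_neg hB) hA, hg A hA, map_zero]
  obtain ⟨m, hm⟩ := h f (fun A hA => if_neg hA)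
    (fun A => by
      simp only [f]
      split_ifs
      · exact homDeg_homPart _ _ _
      · intro l e hne; simp at hne)
    (fun A => by rw [hf]; exact hmem _)
  have hlift : ∀ A, ∃ x, A.card = i + 1 → φ x = f A - koszulD K m A := fun A => by
    by_cases hA : A.card = i + 1
    · have := hm A hA
      rw [← hZ] at this
      obtain ⟨x, hx⟩ := this
      exact ⟨x, fun _ => hx⟩
    · exact ⟨0, fun h => absurd h hA⟩
  choose z hz using hlift
  refine ⟨z, fun A hA => ?_⟩
  rw [LinearMap.mem_ker, map_sub, ← koszulD_map, koszulD_congr (g := fun B => f B - koszulD K m B)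
    (fun B hB => hz B hB) hA, koszulD_sub, koszulD_koszulD, hf, sub_zero, sub_self]

end GradedFree

section Resolutions

variable {K : Type} [Field K] {n : ℕ}

theorem weight_one_eq_degree (e : Fin n →₀ ℕ) : Finsupp.weight (1 : Fin n → ℕ) e = e.degree :=
  (DFunLike.congr_fun Finsupp.degree_eq_weight_one e).symm

/-- A finite homogeneous generating family of minimal size has all its relations in the
maximal homogeneous ideal. -/
theorem exists_minimal_cover {s : ℕ} (w : Fin s → ℕ)
    (Z : Submodule (SRing K n) (Fin s →₀ SRing K n))
    (hZ : ∀ x ∈ Z, ∀ j, homPart w j x ∈ Z) :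
    ∃ (s' : ℕ) (w' : Fin s' → ℕ) (φ : (Fin s' →₀ SRing K n) →ₗ[SRing K n] (Fin s →₀ SRing K n)),
      IsGradedMap w' w φ ∧ LinearMap.range φ = Z ∧
        ∀ x ∈ LinearMap.ker φ, ∀ l, coeff 0 (x l) = 0 := by
  classical
  have hex : ∃ s' : ℕ, ∃ (w' : Fin s' → ℕ) (g : Fin s' → (Fin s →₀ SRing K n)),
      (∀ k, HomDeg w (w' k) (g k)) ∧ Submodule.span (SRing K n) (Set.range g) = Z := by
    let T : Set (Fin s →₀ SRing K n) := {x | x ∈ Z ∧ ∃ j, HomDeg w j x}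
    have hT : Submodule.span (SRing K n) T = Z := by
      refine le_antisymm (Submodule.span_le.2 fun x hx => hx.1) fun x hx => ?_
      let J : Finset ℕ := Finset.univ.biUnion fun l => (x l).support.image fun e => e.degree + w l
      have hxs : x = ∑ j ∈ J, homPart w j x := by
        refine finsupp_ext_coeff fun l e => ?_
        rw [Finsupp.finsetSum_apply, coeff_sum]
        simp only [coeff_homPart]
        rw [Finset.sum_ite_eq]
        split_ifs with h
        · rfl
        · by_contra hne
          refine h (Finset.mem_biUnion.2 ⟨l, Finset.mem_univ _, Finset.mem_image.2 ⟨e, ?_, rfl⟩⟩)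
          rwa [mem_support_iff]
      rw [hxs]
      exact Submodule.sum_mem _ fun j _ =>
        Submodule.subset_span ⟨hZ x hx j, j, homDeg_homPart _ _ _⟩
    obtain ⟨T', hT', hspan⟩ := (Submodule.fg_span_iff_fg_span_finset_subset T).1
      (IsNoetherian.noetherian (R := SRing K n) _)
    have hd : ∀ k : Fin T'.card, ∃ j, HomDeg w j ((T'.equivFin.symm k : T') : Fin s →₀ SRing K n) :=
      fun k => (hT' (T'.equivFin.symm k).2).2
    choose w' hw' using hd
    refine ⟨T'.card, w', fun k => (T'.equivFin.symm k : T'), hw', ?_⟩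
    rw [← hT, hspan]
    congr 1
    ext x
    constructor
    · rintro ⟨k, rfl⟩
      exact (T'.equivFin.symm k).2
    · intro hx
      exact ⟨T'.equivFin ⟨x, hx⟩, by simp⟩
  obtain ⟨w', g, hg, hspan⟩ := Nat.find_spec hex
  have hmin := fun m => Nat.find_min hex (m := m)
  revert w' g
  generalize Nat.find hex = s' at hmin
  intro w' g hg hspan
  have hφ : IsGradedMap w' w (Finsupp.linearCombination (SRing K n) g) := fun k => by
    rw [Finsupp.linearCombination_single, one_smul]; exact hg k
  refine ⟨s', w', Finsupp.linearCombination (SRing K n) g, hφ, ?_, ?_⟩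
  · rw [Finsupp.range_linearCombination, hspan]
  · intro x hx l
    by_contra hne
    obtain ⟨m, rfl⟩ : ∃ m, s' = m + 1 := ⟨s' - 1, by have := l.pos; omega⟩
    refine hmin m (Nat.lt_succ_self m) ⟨w' ∘ l.succAbove, g ∘ l.succAbove,
      fun k => hg _, ?_⟩
    rw [← hspan]
    refine le_antisymm (Submodule.span_mono (Set.range_comp_subset_range _ _)) ?_
    rw [Submodule.span_le]
    have hl : g l ∈ Submodule.span (SRing K n) (Set.range (g ∘ l.succAbove)) := by
      have hy : Finsupp.linearCombination (SRing K n) g (homPart w' (w' l) x) = 0 := by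
        rw [hφ.map_homPart, LinearMap.mem_ker.1 hx, homPart_zero]
      have hyl : homPart w' (w' l) x l = C (coeff 0 (x l)) := by
        refine MvPolynomial.ext _ _ fun e => ?_
        rw [coeff_homPart, coeff_C]
        by_cases he : e = 0
        · subst he; simp
        · rw [if_neg (Ne.symm he), if_neg]
          intro h
          exact he ((Finsupp.degree_eq_zero_iff e).1 (by omega))
      rw [Finsupp.linearCombination_apply, Finsupp.sum_fintype _ _ (by simp),
        Fin.sum_univ_succAbove _ l, hyl] at hy
      have hgl : g l = (C (-(coeff 0 (x l))⁻¹) : SRing K n) •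
          ∑ i, homPart w' (w' l) x (l.succAbove i) • g (l.succAbove i) := by
        rw [eq_neg_of_add_eq_zero_right hy, smul_neg, smul_smul, ← C_mul, neg_mul,
          inv_mul_cancel₀ hne]
        simp
      rw [hgl]
      exact Submodule.smul_mem _ _ (Submodule.sum_mem _ fun i _ =>
        Submodule.smul_mem _ _ (Submodule.subset_span ⟨i, rfl⟩))
    rintro _ ⟨k, rfl⟩
    by_cases hk : k = l
    · subst hk; exact hl
    · obtain ⟨i, rfl⟩ := Fin.exists_succAbove_eq hk
      exact Submodule.subset_span ⟨i, rfl⟩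

variable (K n) in
/-- A homogeneous submodule of a graded free module of finite rank. -/
structure GradedSubmodule where
  rank : ℕ
  wt : Fin rank → ℕ
  sub : Submodule (SRing K n) (Fin rank →₀ SRing K n)
  homPart_mem : ∀ x ∈ sub, ∀ j, homPart wt j x ∈ sub

namespace GradedSubmodule

/-- The rank of a minimal graded free cover. -/
def coverRank (Z : GradedSubmodule K n) : ℕ :=
  (exists_minimal_cover Z.wt Z.sub Z.homPart_mem).choose

/-- The degrees of the basis of a minimal graded free cover. -/
def coverWt (Z : GradedSubmodule K n) : Fin Z.coverRank → ℕ :=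
  (exists_minimal_cover Z.wt Z.sub Z.homPart_mem).choose_spec.choose

/-- A minimal graded free cover. -/
def cover (Z : GradedSubmodule K n) :
    (Fin Z.coverRank →₀ SRing K n) →ₗ[SRing K n] (Fin Z.rank →₀ SRing K n) :=
  (exists_minimal_cover Z.wt Z.sub Z.homPart_mem).choose_spec.choose_spec.choose

theorem cover_spec (Z : GradedSubmodule K n) :
    IsGradedMap Z.coverWt Z.wt Z.cover ∧ LinearMap.range Z.cover = Z.sub ∧
        ∀ x ∈ LinearMap.ker Z.cover, ∀ l, coeff 0 (x l) = 0 :=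
  (exists_minimal_cover Z.wt Z.sub Z.homPart_mem).choose_spec.choose_spec.choose_spec

/-- The first syzygy module in the minimal resolution. -/
def syz (Z : GradedSubmodule K n) : GradedSubmodule K n where
  rank := Z.coverRank
  wt := Z.coverWt
  sub := LinearMap.ker Z.cover
  homPart_mem x hx j := by
    rw [LinearMap.mem_ker, Z.cover_spec.1.map_homPart, LinearMap.mem_ker.1 hx, homPart_zero]

/-- The iterated syzygy modules in the minimal resolution. -/
def iterSyz (Z : GradedSubmodule K n) : ℕ → GradedSubmodule K n
  | 0 => Z
  | i + 1 => (Z.iterSyz i).syz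

end GradedSubmodule

/-- An ideal as a submodule of the free module of rank one. -/
def idealSub (I : Ideal (SRing K n)) : Submodule (SRing K n) (Fin 1 →₀ SRing K n) :=
  Submodule.comap (Finsupp.lapply 0) I

theorem mem_idealSub {I : Ideal (SRing K n)} {x : Fin 1 →₀ SRing K n} :
    x ∈ idealSub I ↔ x 0 ∈ I := Iff.rfl

theorem isGradedMap_diff {I : Ideal (SRing K n)} {r : ℕ∞} (R : GradedPartialRes I r) (i : ℕ) :
    IsGradedMap (R.dg (i + 1)) (R.dg i) (R.diff i) := by
  intro k l e hne
  rcases R.diff_hom i k l with h | ⟨m, hm, h⟩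
  · rw [h] at hne; exact absurd (coeff_zero _) hne
  · have := hm hne
    rw [weight_one_eq_degree] at this
    omega

theorem range_lsingle_comp {I : Ideal (SRing K n)} {M : Type} [AddCommGroup M]
    [Module (SRing K n) M] (φ : M →ₗ[SRing K n] SRing K n) (h : LinearMap.range φ = I) :
    LinearMap.range ((Finsupp.lsingle (0 : Fin 1)).comp φ) = idealSub I := by
  ext x
  rw [mem_idealSub, ← h]
  constructor
  · rintro ⟨y, rfl⟩
    exact ⟨y, by simp⟩
  · rintro ⟨y, hy⟩
    refine ⟨y, ?_⟩
    refine Finsupp.ext fun k => ?_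
    rw [Subsingleton.elim k 0]
    simp [hy]

theorem GradedPartialRes.koszulVanish {I : Ideal (SRing K n)} {r : ℕ∞} (R : GradedPartialRes I r)
    {i j : ℕ} (hi : (i : ℕ∞) < r) (hj : ∀ k, R.dg i k ≠ j) :
    KoszulVanish (fun _ => 0) (idealSub I) (i + 1) j := by
  let Z : ∀ k, Submodule (SRing K n) (Fin (R.s k) →₀ SRing K n) := fun k =>
    match k with
    | 0 => LinearMap.ker R.aug
    | k + 1 => LinearMap.ker (R.diff k)
  have hZ : ∀ k, k ≤ i → LinearMap.range (R.diff k) = Z k := by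
    intro k hk
    have hk' : (k : ℕ∞) < r := lt_of_le_of_lt (by exact_mod_cast hk) hi
    cases k with
    | zero => exact R.exact_zero (by simpa using hk')
    | succ k => exact R.exact_succ k (by simpa using hk')
  have key : ∀ m k, k + m = i → KoszulVanish (R.dg k) (Z k) m j := by
    intro m
    induction m with
    | zero => rintro k rfl; exact koszulVanish_of_no_generator hj
    | succ m ih =>
      intro k hk
      exact KoszulVanish.of_syzygy (isGradedMap_diff R k) (hZ k (by omega)) (ih (k + 1) (by omega))
  have h0 := key i 0 (by omega)
  have hker : Z 0 = LinearMap.ker ((Finsupp.lsingle (0 : Fin 1)).comp R.aug) := by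
    ext x
    simp [Z]
  rw [hker] at h0
  refine KoszulVanish.of_syzygy ?_ (range_lsingle_comp _ R.aug_range) h0
  intro k l e hne
  rw [Subsingleton.elim l 0] at hne
  have := R.aug_hom k (d := e) (by simpa using hne)
  rw [weight_one_eq_degree] at this
  omega

/-- A homogeneous ideal as a graded submodule of the free module of rank one. -/
def idealGradedSub (I : Ideal (SRing K n)) (hI : ∀ p ∈ I, ∀ j, homogeneousComponent j p ∈ I) :
    GradedSubmodule K n where
  rank := 1
  wt _ := 0
  sub := idealSub I
  homPart_mem x hx j := by
    rw [mem_idealSub]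
    have : homPart (fun _ => 0) j x 0 = homogeneousComponent j (x 0) := by
      simp [homPart]
    rw [this]
    exact hI _ hx j

/-- The augmentation of the minimal graded free resolution of a homogeneous ideal. -/
def minAug (I : Ideal (SRing K n)) (hI : ∀ p ∈ I, ∀ j, homogeneousComponent j p ∈ I) :
    (Fin (idealGradedSub I hI).syz.rank →₀ SRing K n) →ₗ[SRing K n] SRing K n :=
  (Finsupp.lapply (M := SRing K n) (R := SRing K n) (0 : Fin 1)).comp
    (show (Fin (idealGradedSub I hI).syz.rank →₀ SRing K n) →ₗ[SRing K n] (Fin 1 →₀ SRing K n)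
      from (idealGradedSub I hI).cover)

theorem range_minAug (I : Ideal (SRing K n))
    (hI : ∀ p ∈ I, ∀ j, homogeneousComponent j p ∈ I) : LinearMap.range (minAug I hI) = I := by
  have h : LinearMap.range (idealGradedSub I hI).cover = idealSub I :=
    (idealGradedSub I hI).cover_spec.2.1
  ext p
  constructor
  · rintro ⟨x, rfl⟩
    have hx : (idealGradedSub I hI).cover x ∈ idealSub I := h ▸ ⟨x, rfl⟩
    exact hx
  · intro hp
    have hs : Finsupp.single (0 : Fin 1) p ∈ idealSub I := by simpa [mem_idealSub] using hp
    rw [← h] at hs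
    obtain ⟨x, hx⟩ := hs
    refine ⟨x, ?_⟩
    change (show Fin 1 →₀ SRing K n from (idealGradedSub I hI).cover x) 0 = p
    rw [hx]
    simp

theorem ker_minAug (I : Ideal (SRing K n))
    (hI : ∀ p ∈ I, ∀ j, homogeneousComponent j p ∈ I) :
    LinearMap.ker (idealGradedSub I hI).cover = LinearMap.ker (minAug I hI) := by
  ext x
  refine ⟨fun h => ?_, fun h => Finsupp.ext fun l => ?_⟩
  · change (show Fin 1 →₀ SRing K n from (idealGradedSub I hI).cover x) 0 = 0
    rw [LinearMap.mem_ker.1 h]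
    rfl
  · have hl : l = (0 : Fin 1) := Subsingleton.elim (α := Fin 1) _ _
    subst hl
    exact h

/-- The minimal graded free resolution of a homogeneous ideal. -/
def minRes (I : Ideal (SRing K n)) (hI : ∀ p ∈ I, ∀ j, homogeneousComponent j p ∈ I) (r : ℕ∞) :
    GradedPartialRes I r where
  s i := ((idealGradedSub I hI).iterSyz (i + 1)).rank
  dg i := ((idealGradedSub I hI).iterSyz (i + 1)).wt
  aug := minAug I hI
  diff i := ((idealGradedSub I hI).iterSyz (i + 1)).cover
  aug_hom k e hne := by
    have := (idealGradedSub I hI).cover_spec.1 k (0 : Fin 1) e hne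
    rw [weight_one_eq_degree]
    exact this
  diff_hom i k l := by
    by_cases h : ((idealGradedSub I hI).iterSyz (i + 1)).cover (Finsupp.single k 1) l = 0
    · exact Or.inl h
    · right
      obtain ⟨e, he⟩ := MvPolynomial.ne_zero_iff.1 h
      have hspec := ((idealGradedSub I hI).iterSyz (i + 1)).cover_spec.1 k l
      refine ⟨e.degree, fun e' he' => ?_, ?_⟩
      · rw [weight_one_eq_degree]
        have h1 := hspec e he
        have h2 := hspec e' he'
        omega
      · have h1 := hspec e he
        rw [add_comm]; exact h1
  aug_range := range_minAug I hI
  exact_zero _ := ((idealGradedSub I hI).iterSyz 1).cover_spec.2.1.trans (ker_minAug I hI)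
  exact_succ i _ := ((idealGradedSub I hI).iterSyz (i + 2)).cover_spec.2.1

theorem gradedBetti_eq_zero_of_koszulVanish {I : Ideal (SRing K n)}
    (hI : ∀ p ∈ I, ∀ j, homogeneousComponent j p ∈ I) (h0 : ∀ p ∈ I, coeff 0 p = 0) {i j : ℕ}
    (h : KoszulVanish (fun _ => 0) (idealSub I) (i + 1) j) : gradedBetti I i j = 0 := by
  have hmin : ∀ k, ∀ x ∈ ((idealGradedSub I hI).iterSyz k).sub, ∀ l, coeff 0 (x l) = 0 := by
    intro k
    cases k with
    | zero =>
      intro x hx l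
      have : l = (0 : Fin 1) := Subsingleton.elim (α := Fin 1) _ _
      subst this
      exact h0 _ hx
    | succ k => exact ((idealGradedSub I hI).iterSyz k).cover_spec.2.2
  have key : ∀ k m, k + m = i + 1 → KoszulVanish ((idealGradedSub I hI).iterSyz k).wt
      ((idealGradedSub I hI).iterSyz k).sub m j := by
    intro k
    induction k with
    | zero => intro m hm; rw [zero_add] at hm; subst hm; exact h
    | succ k ih =>
      intro m hm
      exact KoszulVanish.syzygy ((idealGradedSub I hI).iterSyz k).cover_spec.1
        ((idealGradedSub I hI).iterSyz k).cover_spec.2.1 (hmin k) (ih (m + 1) (by omega))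
  have hfin := (key (i + 1) 0 rfl).no_generator (hmin (i + 1))
  refine le_antisymm (iInf_le_of_le (minRes I hI _) ?_) bot_le
  rw [Finset.filter_false_of_mem]
  · simp
  · exact fun l _ => hfin l

theorem koszulVanish_of_gradedBetti_eq_zero {I : Ideal (SRing K n)} {i j : ℕ}
    (h : gradedBetti I i j = 0) : KoszulVanish (fun _ => 0) (idealSub I) (i + 1) j := by
  rw [gradedBetti, ENat.iInf_eq_zero] at h
  obtain ⟨R, hR⟩ := h
  refine R.koszulVanish (by exact_mod_cast Nat.lt_succ_self i) fun k hk => ?_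
  rw [Nat.cast_eq_zero, Finset.card_eq_zero] at hR
  have : k ∈ (Finset.univ.filter fun k => R.dg i k = j) := by simp [hk]
  rw [hR] at this
  simp at this

end Resolutions

section Hochster

variable {K : Type} [Field K] {n : ℕ}

theorem koszulVanish_idealSub_iff {I : Ideal (SRing K n)} {i j : ℕ} :
    KoszulVanish (fun _ => 0) (idealSub I) i j ↔
      ∀ f : Finset (Fin n) → SRing K n, (∀ A, A.card ≠ i → f A = 0) →
        (∀ A e, coeff e (f A) ≠ 0 → e.degree + A.card = j) → (∀ A, koszulD K f A ∈ I) →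
        ∃ g, ∀ A, A.card = i → f A - koszulD K g A ∈ I := by
  have happ : ∀ (f : Finset (Fin n) → (Fin 1 →₀ SRing K n)) A,
      koszulD K f A 0 = koszulD K (fun B => f B 0) A := fun f A =>
    (koszulD_map (K := K) (Finsupp.lapply (M := SRing K n) (R := SRing K n) (0 : Fin 1)) f A).symm
  constructor
  · intro h f hf hdeg hd
    obtain ⟨g, hg⟩ := h (fun A => Finsupp.single 0 (f A)) (fun A hA => by simp [hf A hA])
      (fun A l e hne => by
        rw [Subsingleton.elim l 0] at hne
        simpa using hdeg A e (by simpa using hne))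
      (fun A => by
        rw [mem_idealSub, happ]
        simpa using hd A)
    refine ⟨fun A => g A 0, fun A hA => ?_⟩
    have := hg A hA
    rw [mem_idealSub, Finsupp.sub_apply, happ] at this
    simpa using this
  · intro h f hf hdeg hd
    obtain ⟨g, hg⟩ := h (fun A => f A 0) (fun A hA => by simp [hf A hA])
      (fun A e hne => by simpa using hdeg A 0 e hne)
      (fun A => by rw [← happ]; exact hd A)
    refine ⟨fun A => Finsupp.single 0 (g A), fun A hA => ?_⟩
    rw [mem_idealSub, Finsupp.sub_apply, happ]
    simpa using hg A hA

/-- The faces of the independence complex of `G`. -/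
def IsFace (G : SimpleGraph (Fin n)) (σ : Finset (Fin n)) : Prop :=
  ∀ a ∈ σ, ∀ b ∈ σ, ¬ G.Adj a b

theorem mem_edgeIdeal_iff (G : SimpleGraph (Fin n)) (p : SRing K n) :
    p ∈ edgeIdeal K G.Adj ↔ ∀ e, IsFace G e.support → coeff e p = 0 := by
  have h : edgeIdeal K G.Adj = Ideal.span ((fun s => monomial s (1 : K)) ''
      {s | ∃ i j, G.Adj i j ∧ s = Finsupp.single i 1 + Finsupp.single j 1}) := by
    rw [edgeIdeal]
    congr 1
    ext p
    constructor
    · rintro ⟨i, j, hij, rfl⟩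
      exact ⟨_, ⟨i, j, hij, rfl⟩, by simp [X, monomial_mul]⟩
    · rintro ⟨_, ⟨i, j, hij, rfl⟩, rfl⟩
      exact ⟨i, j, hij, by simp [X, monomial_mul]⟩
  rw [h, mem_ideal_span_monomial_image]
  constructor
  · intro hp e he
    by_contra hne
    obtain ⟨_, ⟨i, j, hij, rfl⟩, hle⟩ := hp e (mem_support_iff.2 hne)
    refine he i ?_ j ?_ hij
    · have := hle i
      rw [Finsupp.mem_support_iff]
      simp only [Finsupp.add_apply, Finsupp.single_eq_same] at this
      omega
    · have := hle j
      rw [Finsupp.mem_support_iff]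
      simp only [Finsupp.add_apply, Finsupp.single_eq_same] at this
      omega
  · intro hp e he
    have : ¬ IsFace G e.support := fun hf => mem_support_iff.1 he (hp e hf)
    simp only [IsFace, not_forall, not_not] at this
    obtain ⟨i, hi, j, hj, hij⟩ := this
    refine ⟨_, ⟨i, j, hij, rfl⟩, fun v => ?_⟩
    rw [Finsupp.mem_support_iff] at hi hj
    have hne := hij.ne
    simp only [Finsupp.add_apply, Finsupp.single_apply]
    split_ifs with h1 h2 h2
    · exact absurd (h1.trans h2.symm) hne
    · subst h1; omega
    · subst h2; omega
    · omega

/-- The simplicial coboundary on functions of finite sets. -/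
def simplicialD (u : Finset (Fin n) → K) (σ : Finset (Fin n)) : K :=
  ∑ v ∈ σ, insSign v σ • u (σ.erase v)

variable (K) in
/-- Cochains of the independence complex of `G` restricted to `W` that are supported on faces
with `m` vertices: every cocycle is a coboundary. -/
def CohomVanish (G : SimpleGraph (Fin n)) (W : Finset (Fin n)) (m : ℕ) : Prop :=
  ∀ u : Finset (Fin n) → K,
    (∀ σ ⊆ W, IsFace G σ → σ.card = m + 1 → simplicialD u σ = 0) →
    ∃ φ : Finset (Fin n) → K, ∀ σ ⊆ W, IsFace G σ → σ.card = m → u σ = simplicialD φ σ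

/-- The sign relating Koszul and simplicial differentials under complementation in `W`. -/
def complSign (W σ : Finset (Fin n)) : ℤ := ∏ w ∈ σ, insSign w W

theorem complSign_mul_self (W σ : Finset (Fin n)) : complSign W σ * complSign W σ = 1 := by
  rw [complSign, ← Finset.prod_mul_distrib]
  exact Finset.prod_eq_one fun w _ => insSign_mul_self w W

theorem insSign_sdiff (v : Fin n) {W σ : Finset (Fin n)} (h : σ ⊆ W) :
    insSign v (W \ σ) = insSign v W * insSign v σ := by
  have h1 : insSign v W = insSign v (W \ σ) * insSign v σ := by
    unfold insSign
    rw [← pow_add, ← Finset.card_union_of_disjoint, ← Finset.filter_union,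
      Finset.sdiff_union_of_subset h]
    exact Finset.disjoint_filter_filter Finset.sdiff_disjoint
  rw [h1, mul_assoc, insSign_mul_self, mul_one]

/-- Passage from Koszul to simplicial cochains by complementation in `W`. -/
def complTwist (W : Finset (Fin n)) (c : Finset (Fin n) → K) (σ : Finset (Fin n)) : K :=
  complSign W σ • c (W \ σ)

theorem support_sqfreeExp (W : Finset (Fin n)) : (sqfreeExp W).support = W := by
  ext v
  simp [Finsupp.mem_support_iff, sqfreeExp_apply]

theorem sqfreeExp_sub {W A : Finset (Fin n)} :
    sqfreeExp W - sqfreeExp A = sqfreeExp (W \ A) := by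
  ext v
  simp only [Finsupp.tsub_apply, sqfreeExp_apply, Finset.mem_sdiff]
  by_cases h1 : v ∈ W <;> by_cases h2 : v ∈ A <;> simp [h1, h2]

theorem degree_sqfreeExp (W : Finset (Fin n)) : (sqfreeExp W).degree = W.card := by
  rw [Finsupp.degree_apply, support_sqfreeExp, Finset.sum_congr rfl (g := fun _ => 1)]
  · simp
  · intro v hv; simp [sqfreeExp_apply, hv]

theorem simplicialD_complTwist (W : Finset (Fin n)) (c : Finset (Fin n) → K)
    {σ : Finset (Fin n)} (hσ : σ ⊆ W) :
    simplicialD (complTwist W c) σ = complSign W σ • multiD (sqfreeExp W) c (W \ σ) := by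
  rw [simplicialD, multiD, support_sqfreeExp, Finset.sdiff_sdiff_eq_self hσ, Finset.smul_sum]
  refine Finset.sum_congr rfl fun v hv => ?_
  have hset : W \ σ.erase v = insert v (W \ σ) := by
    ext u
    by_cases huv : u = v
    · subst huv; simp [hσ hv]
    · simp [huv]
  have hsgn : complSign W σ = insSign v W * complSign W (σ.erase v) :=
    (Finset.mul_prod_erase σ _ hv).symm
  rw [complTwist, hset, smul_smul, smul_smul, insSign_sdiff v hσ, hsgn]
  congr 1
  linear_combination -(insSign v σ * complSign W (σ.erase v)) * insSign_mul_self v W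

theorem complTwist_complTwist (W : Finset (Fin n)) (c : Finset (Fin n) → K)
    {σ : Finset (Fin n)} (hσ : σ ⊆ W) :
    complTwist W (fun A => complSign W (W \ A) • c (W \ A)) σ = c σ := by
  rw [complTwist, Finset.sdiff_sdiff_eq_self hσ, smul_smul, complSign_mul_self, one_smul]

theorem cohomVanish_of_koszulVanish {G : SimpleGraph (Fin n)} {i m : ℕ}
    (h : KoszulVanish (fun _ => 0) (idealSub (edgeIdeal K G.Adj)) i (i + m))
    {W : Finset (Fin n)} (hW : W.card = i + m) : CohomVanish K G W m := by
  classical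
  rw [koszulVanish_idealSub_iff] at h
  intro u hu
  let c : Finset (Fin n) → K := fun A =>
    if A.card = i then complSign W (W \ A) • u (W \ A) else 0
  let f : Finset (Fin n) → SRing K n := fun A =>
    if A ⊆ W then monomial (sqfreeExp (W \ A)) (c A) else 0
  have hfW : ∀ A ⊆ W, multiCoeff (sqfreeExp W) f A = c A := by
    intro A hA
    simp only [multiCoeff, f, if_pos hA, sqfreeExp_sub, coeff_monomial, if_true]
  have hfβ : ∀ β ≠ sqfreeExp W, ∀ A ⊆ β.support, multiCoeff β f A = 0 := by
    intro β hβ A hA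
    simp only [multiCoeff, f]
    split_ifs with hAW
    · rw [coeff_monomial, if_neg]
      intro heq
      rw [← sqfreeExp_sub] at heq
      exact hβ (tsub_sqfreeExp_injective hA (by rwa [support_sqfreeExp]) heq.symm)
    · simp
  have hcu : ∀ σ ⊆ W, σ.card = m → complTwist W c σ = u σ := by
    intro σ hσ hm
    rw [← complTwist_complTwist W u hσ]
    simp only [complTwist, c]
    rw [if_pos (by rw [Finset.card_sdiff_of_subset hσ]; omega)]
  obtain ⟨g, hg⟩ := h f
    (fun A hA => by
      simp only [f, c, if_neg hA, monomial_zero, ite_self])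
    (fun A e hne => by
      simp only [f] at hne
      split_ifs at hne with hAW
      · rw [coeff_monomial] at hne
        split_ifs at hne with he
        · rw [← he, degree_sqfreeExp, Finset.card_sdiff_of_subset hAW, hW]
          have := Finset.card_le_card hAW
          omega
        · exact absurd rfl hne
      · simp at hne)
    (fun A => by
      rw [mem_edgeIdeal_iff]
      intro e he
      have hA := support_add_sqfreeExp e A
      have heβ : e = (e + sqfreeExp A) - sqfreeExp A := by rw [add_tsub_cancel_right]
      have hgoal : multiCoeff (e + sqfreeExp A) (koszulD K f) A = 0 := by
        rw [multiCoeff_koszulD]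
        by_cases hβ : e + sqfreeExp A = sqfreeExp W
        · rw [hβ] at hA ⊢
          rw [support_sqfreeExp] at hA
          have hD : multiD (sqfreeExp W) (multiCoeff (sqfreeExp W) f) A =
              multiD (sqfreeExp W) c A := by
            refine Finset.sum_congr rfl fun v hv => ?_
            rw [support_sqfreeExp] at hv
            rw [hfW _ (Finset.insert_subset (Finset.mem_sdiff.1 hv).1 hA)]
          rw [hD]
          by_cases hAi : A.card + 1 = i
          · have hσW : W \ A ⊆ W := Finset.sdiff_subset
            have hσ : (W \ A).card = m + 1 := by
              rw [Finset.card_sdiff_of_subset hA]; omega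
            have h1 := simplicialD_complTwist W c hσW
            have h2 : simplicialD (complTwist W c) (W \ A) = simplicialD u (W \ A) := by
              refine Finset.sum_congr rfl fun v hv => ?_
              rw [hcu _ ((Finset.erase_subset _ _).trans hσW)
                (by rw [Finset.card_erase_of_mem hv, hσ]; rfl)]
            have hface : IsFace G (W \ A) := by
              have hsup : W \ A = e.support := by
                rw [← support_sqfreeExp (W \ A), ← sqfreeExp_sub, ← hβ, add_tsub_cancel_right]
              rw [hsup]
              exact he
            rw [Finset.sdiff_sdiff_eq_self hA] at h1
            rw [h2, hu _ hσW hface hσ] at h1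
            have h3 := congrArg (complSign W (W \ A) • ·) h1
            simp only [smul_zero, smul_smul, complSign_mul_self, one_smul] at h3
            exact h3.symm
          · refine Finset.sum_eq_zero fun v hv => ?_
            have hvA := (Finset.mem_sdiff.1 hv).2
            simp only [c]
            rw [if_neg (by rw [Finset.card_insert_of_notMem hvA]; exact hAi), smul_zero]
        · refine Finset.sum_eq_zero fun v hv => ?_
          rw [hfβ _ hβ _ (Finset.insert_subset (Finset.mem_sdiff.1 hv).1 hA), smul_zero]
      rw [heβ]
      exact hgoal)
  refine ⟨complTwist W (multiCoeff (sqfreeExp W) g), fun σ hσ hface hm => ?_⟩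
  have hσi : (W \ σ).card = i := by rw [Finset.card_sdiff_of_subset hσ]; omega
  have h1 := (mem_edgeIdeal_iff G _).1 (hg (W \ σ) hσi) (sqfreeExp σ)
    (by rwa [support_sqfreeExp])
  rw [coeff_sub, sub_eq_zero] at h1
  have hexp : sqfreeExp σ = sqfreeExp W - sqfreeExp (W \ σ) := by
    rw [sqfreeExp_sub, Finset.sdiff_sdiff_eq_self hσ]
  rw [simplicialD_complTwist W _ hσ, ← multiCoeff_koszulD, ← hcu σ hσ hm, complTwist,
    ← hfW _ Finset.sdiff_subset]
  congr 1
  rw [multiCoeff, multiCoeff, ← hexp]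
  exact h1

theorem degree_sub_sqfreeExp {β : Fin n →₀ ℕ} {A : Finset (Fin n)} (hA : A ⊆ β.support) :
    (β - sqfreeExp A).degree + A.card = β.degree := by
  rw [← degree_sqfreeExp, ← map_add, tsub_add_cancel_of_le (sqfreeExp_le hA)]

theorem koszulVanish_of_cohomVanish {G : SimpleGraph (Fin n)} {i m : ℕ}
    (h : ∀ W : Finset (Fin n), W.card = i + m → CohomVanish K G W m) :
    KoszulVanish (fun _ => 0) (idealSub (edgeIdeal K G.Adj)) i (i + m) := by
  classical
  rw [koszulVanish_idealSub_iff]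
  intro f hf hdeg hd
  have hd' : ∀ β A, IsFace G (β - sqfreeExp A).support → multiD β (multiCoeff β f) A = 0 := by
    intro β A hface
    rw [← multiCoeff_koszulD]
    exact (mem_edgeIdeal_iff G _).1 (hd A) _ hface
  obtain ⟨g, hg⟩ := exists_koszulD_of_multiD f (fun A e => A.card = i ∧ IsFace G e.support)
    fun β => by
      by_cases hβ : β.degree = i + m
      · by_cases h2 : ∃ v, 2 ≤ β v
        · obtain ⟨v, hv⟩ := h2
          obtain ⟨b, hb⟩ := exists_multiD_of_cone β v
            (by rw [Finsupp.mem_support_iff]; omega) (multiCoeff β f)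
          refine ⟨b, fun A hA hface => hb A hA fun hvA => hd' _ _ ?_⟩
          convert hface.2 using 1
          ext u
          simp only [Finsupp.mem_support_iff, Finsupp.tsub_apply, sqfreeExp_apply,
            Finset.mem_erase]
          by_cases huv : u = v
          · subst huv; simp [hvA]; omega
          · simp [huv]
        · have hβ1 : β = sqfreeExp β.support := by
            ext v
            simp only [not_exists, not_le] at h2
            have := h2 v
            rw [sqfreeExp_apply]
            split_ifs with hv <;> rw [Finsupp.mem_support_iff] at hv <;> omega
          obtain ⟨W, rfl⟩ : ∃ W, β = sqfreeExp W := ⟨_, hβ1⟩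
          rw [degree_sqfreeExp] at hβ
          obtain ⟨φ, hφ⟩ := h W hβ (complTwist W (multiCoeff (sqfreeExp W) f))
            (fun σ hσ hface _ => by
              rw [simplicialD_complTwist W _ hσ, hd', smul_zero]
              rwa [sqfreeExp_sub, support_sqfreeExp, Finset.sdiff_sdiff_eq_self hσ])
          refine ⟨fun A => complSign W (W \ A) • φ (W \ A), fun A hA hface => ?_⟩
          rw [support_sqfreeExp] at hA
          rw [sqfreeExp_sub, support_sqfreeExp] at hface
          have hσ : W \ A ⊆ W := Finset.sdiff_subset
          have h3 := hφ (W \ A) hσ hface.2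
            (by rw [Finset.card_sdiff_of_subset hA]; omega)
          have h4 : simplicialD φ (W \ A) = simplicialD
              (complTwist W fun A => complSign W (W \ A) • φ (W \ A)) (W \ A) := by
            refine Finset.sum_congr rfl fun v _ => ?_
            rw [complTwist_complTwist W φ ((Finset.erase_subset _ _).trans hσ)]
          rw [h4, simplicialD_complTwist W _ hσ, complTwist, Finset.sdiff_sdiff_eq_self hA] at h3
          have h5 := congrArg (complSign W (W \ A) • ·) h3
          simpa only [smul_smul, complSign_mul_self, one_smul] using h5
      · refine ⟨0, fun A hA _ => ?_⟩
        have hz : multiD β (0 : Finset (Fin n) → K) A = 0 := by simp [multiD]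
        rw [hz]
        by_contra hne
        exact hβ ((degree_sub_sqfreeExp hA).symm.trans (hdeg A _ hne))
  refine ⟨g, fun A hA => ?_⟩
  rw [mem_edgeIdeal_iff]
  intro e he
  rw [coeff_sub, hg A e ⟨hA, he⟩, sub_self]

theorem homogeneousComponent_mem_edgeIdeal (G : SimpleGraph (Fin n)) (p : SRing K n)
    (hp : p ∈ edgeIdeal K G.Adj) (j : ℕ) : homogeneousComponent j p ∈ edgeIdeal K G.Adj := by
  rw [mem_edgeIdeal_iff] at hp ⊢
  intro e he
  rw [coeff_homogeneousComponent, hp e he, ite_self]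

theorem coeff_zero_of_mem_edgeIdeal (G : SimpleGraph (Fin n)) (p : SRing K n)
    (hp : p ∈ edgeIdeal K G.Adj) : coeff 0 p = 0 :=
  (mem_edgeIdeal_iff G p).1 hp 0 (by simp [IsFace])

end Hochster

section InducedCycles

variable {n : ℕ}

/-- `p` runs periodically through an induced cycle of length `l ≥ 4` in the complement of `G`. -/
structure IndCyc (G : SimpleGraph (Fin n)) (l : ℕ) (p : ℕ → Fin n) : Prop where
  four_le : 4 ≤ l
  periodic : ∀ k, p (k + l) = p k
  adj_succ : ∀ k, Gᶜ.Adj (p k) (p (k + 1))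
  adj_add : ∀ k d, 2 ≤ d → d + 2 ≤ l → G.Adj (p k) (p (k + d))

namespace IndCyc

variable {G : SimpleGraph (Fin n)} {l : ℕ} {p : ℕ → Fin n}

theorem shift (h : IndCyc G l p) (s : ℕ) : IndCyc G l (fun k => p (s + k)) where
  four_le := h.four_le
  periodic k := by rw [← add_assoc, h.periodic]
  adj_succ k := h.adj_succ (s + k)
  adj_add k d h1 h2 := by
    rw [← add_assoc]
    exact h.adj_add (s + k) d h1 h2

theorem ne_add (h : IndCyc G l p) {k d : ℕ} (h1 : 1 ≤ d) (h2 : d < l) : p k ≠ p (k + d) := by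
  rcases Nat.lt_or_ge d 2 with hd | hd
  · obtain rfl : d = 1 := by omega
    exact (h.adj_succ k).ne
  rcases Nat.lt_or_ge l (d + 2) with hl | hl
  · have := (h.adj_succ (k + d)).ne
    rw [show k + d + 1 = k + l by omega, h.periodic] at this
    exact this.symm
  · exact (h.adj_add k d hd hl).ne

/-- The vertices of the cycle. -/
def verts (l : ℕ) (p : ℕ → Fin n) : Finset (Fin n) := (Finset.range l).image p

theorem mem_verts (h : IndCyc G l p) (k : ℕ) : p k ∈ verts l p := by
  have hl : 0 < l := by have := h.four_le; omega
  have hk : p k = p (k % l) := by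
    conv_lhs => rw [← Nat.mod_add_div k l]
    induction k / l with
    | zero => simp
    | succ m ih => rw [Nat.mul_succ, ← add_assoc, h.periodic, ih]
  rw [hk]
  exact Finset.mem_image_of_mem _ (Finset.mem_range.2 (Nat.mod_lt _ hl))

theorem exists_of_mem_verts (h : IndCyc G l p) {x : Fin n} (hx : x ∈ verts l p) (s : ℕ) :
    ∃ d < l, x = p (s + d) := by
  obtain ⟨m, hm, rfl⟩ := Finset.mem_image.1 hx
  rw [Finset.mem_range] at hm
  have hl : 0 < l := by omega
  refine ⟨(m + s * l - s) % l, Nat.mod_lt _ hl, ?_⟩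
  have hper : ∀ a b, p (a + l * b) = p a := by
    intro a b
    induction b with
    | zero => simp
    | succ b ih => rw [Nat.mul_succ, ← add_assoc, h.periodic, ih]
  have hs : s ≤ s * l := Nat.le_mul_of_pos_right s hl
  rw [← hper (s + _) ((m + s * l - s) / l), add_assoc, Nat.mod_add_div,
    show s + (m + s * l - s) = m + l * s by rw [mul_comm l s]; omega, hper]

theorem card_verts (h : IndCyc G l p) : (verts l p).card = l := by
  rw [verts, Finset.card_image_of_injOn, Finset.card_range]
  have key : ∀ a b, a < b → b < l → p a ≠ p b := by
    intro a b hab hb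
    have := h.ne_add (k := a) (d := b - a) (by omega) (by omega)
    rwa [show a + (b - a) = b by omega] at this
  intro a ha b hb hab
  simp only [Finset.coe_range, Set.mem_Iio] at ha hb
  rcases lt_trichotomy a b with hlt | heq | hlt
  · exact absurd hab (key a b hlt hb)
  · exact heq
  · exact absurd hab.symm (key b a hlt ha)

theorem adj_of_mem_verts (h : IndCyc G l p) {x : Fin n} (hx : x ∈ verts l p) (h0 : x ≠ p 0)
    (h1 : x ≠ p 1) : G.Adj (p 0) x ∨ G.Adj (p 1) x := by
  have hl := h.four_le
  obtain ⟨d, hd, rfl⟩ := h.exists_of_mem_verts hx 0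
  rw [Nat.zero_add] at h0 h1 ⊢
  have hd0 : d ≠ 0 := fun hd0 => h0 (by rw [hd0])
  have hd1 : d ≠ 1 := fun hd1 => h1 (by rw [hd1])
  rcases Nat.lt_or_ge l (d + 2) with hdl | hdl
  · right
    have := h.adj_add 1 (d - 1) (by omega) (by omega)
    rwa [show 1 + (d - 1) = d by omega] at this
  · left
    have := h.adj_add 0 d (by omega) hdl
    rwa [Nat.zero_add] at this

theorem of_list {q : ℕ → Fin n} (hl : 4 ≤ l) (h1 : ∀ i, i + 1 < l → Gᶜ.Adj (q i) (q (i + 1)))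
    (h2 : Gᶜ.Adj (q (l - 1)) (q 0))
    (h3 : ∀ i j, i + 2 ≤ j → j < l → (i ≠ 0 ∨ j ≠ l - 1) → G.Adj (q i) (q j)) :
    IndCyc G l (fun m => q (m % l)) where
  four_le := hl
  periodic k := by simp
  adj_succ k := by
    have hk := Nat.mod_lt k (show 0 < l by omega)
    rw [Nat.add_mod, Nat.mod_eq_of_lt (show 1 < l by omega)]
    generalize k % l = r at hk
    rcases Nat.lt_or_ge (r + 1) l with hr | hr
    · rw [Nat.mod_eq_of_lt hr]
      exact h1 r hr
    · obtain rfl : r = l - 1 := by omega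
      rw [show l - 1 + 1 = l by omega, Nat.mod_self]
      exact h2
  adj_add k d hd hdl := by
    have hk := Nat.mod_lt k (show 0 < l by omega)
    rw [Nat.add_mod, Nat.mod_eq_of_lt (show d < l by omega)]
    generalize k % l = r at hk
    rcases Nat.lt_or_ge (r + d) l with hr | hr
    · rw [Nat.mod_eq_of_lt hr]
      exact h3 _ _ (by omega) hr (by omega)
    · rw [Nat.mod_eq_sub_mod hr, Nat.mod_eq_of_lt (by omega)]
      exact (h3 _ _ (by omega) hk (by omega)).symm

end IndCyc

/-- A path in the complement of `G` joining two neighbours of `v` that are separated by a function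
constant on adjacent neighbours of `v` produces an induced cycle. -/
theorem exists_indCyc_of_path {α : Type} {G : SimpleGraph (Fin n)} {v : Fin n}
    {W : Finset (Fin n)} (hv : v ∉ W) {ψ : Fin n → α}
    (hψ : ∀ a b, a ∈ W → b ∈ W → Gᶜ.Adj v a → Gᶜ.Adj v b → Gᶜ.Adj a b → ψ a = ψ b)
    (h : ∃ k, ∃ q : ℕ → Fin n, (∀ i ≤ k, q i ∈ W) ∧ (∀ i < k, Gᶜ.Adj (q i) (q (i + 1))) ∧
      Gᶜ.Adj v (q 0) ∧ Gᶜ.Adj v (q k) ∧ ψ (q 0) ≠ ψ (q k)) :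
    ∃ l p, IndCyc G l p ∧ l ≤ W.card + 1 := by
  classical
  have hmin := fun m (hm : m < Nat.find h) => Nat.find_min h hm
  obtain ⟨q, hqW, hq, h0, hk, hne⟩ := Nat.find_spec h
  generalize Nat.find h = k at *
  have hk0 : k ≠ 0 := by
    rintro rfl
    exact hne rfl
  have hk1 : k ≠ 1 := by
    rintro rfl
    exact hne (hψ _ _ (hqW 0 (by omega)) (hqW 1 le_rfl) h0 hk (hq 0 (by omega)))
  have hnadj : ∀ i j, i + 2 ≤ j → j ≤ k → ¬ Gᶜ.Adj (q i) (q j) := by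
    intro i j hij hjk hadj
    refine hmin (k - (j - i - 1)) (by omega)
      ⟨fun r => if r ≤ i then q r else q (r + (j - i - 1)), ?_, ?_, ?_, ?_, ?_⟩
    · intro r hr
      dsimp only
      split_ifs
      · exact hqW _ (by omega)
      · exact hqW _ (by omega)
    · intro r hr
      dsimp only
      rcases lt_trichotomy r i with hlt | rfl | hlt
      · rw [if_pos hlt.le, if_pos (by omega)]
        exact hq r (by omega)
      · rw [if_pos le_rfl, if_neg (by omega), show r + 1 + (j - r - 1) = j by omega]
        exact hadj
      · rw [if_neg (by omega), if_neg (by omega),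
          show r + 1 + (j - i - 1) = r + (j - i - 1) + 1 by omega]
        exact hq _ (by omega)
    · simpa using h0
    · dsimp only
      rw [if_neg (by omega), show k - (j - i - 1) + (j - i - 1) = k by omega]
      exact hk
    · dsimp only
      rw [if_pos (Nat.zero_le _), if_neg (by omega),
        show k - (j - i - 1) + (j - i - 1) = k by omega]
      exact hne
  have hdist : ∀ i j, i < j → j ≤ k → q i ≠ q j := by
    intro i j hij hjk heq
    rcases Nat.lt_or_ge j k with hj | hj
    · have := hq j hj
      rw [← heq] at this
      exact hnadj i (j + 1) (by omega) (by omega) this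
    · obtain rfl : j = k := by omega
      rcases Nat.eq_zero_or_pos i with rfl | hi
      · exact hne (by rw [heq])
      · have := hq (i - 1) (by omega)
        rw [show i - 1 + 1 = i by omega, heq] at this
        exact hnadj (i - 1) j (by omega) le_rfl this
  have hinterior : ∀ i, 0 < i → i < k → ¬ Gᶜ.Adj v (q i) := by
    intro i hi hik hadj
    by_cases hψi : ψ (q 0) = ψ (q i)
    · refine hmin (k - i) (by omega) ⟨fun r => q (i + r), fun r hr => hqW _ (by omega),
        fun r hr => hq (i + r) (by omega), hadj, ?_, ?_⟩
      · dsimp only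
        rwa [show i + (k - i) = k by omega]
      · dsimp only
        rwa [show i + (k - i) = k by omega, Nat.add_zero, ← hψi]
    · exact hmin i hik ⟨q, fun r hr => hqW _ (by omega), fun r hr => hq r (by omega), h0, hadj, hψi⟩
  have hGadj : ∀ a b, a ≠ b → ¬ Gᶜ.Adj a b → G.Adj a b := by
    intro a b hab h
    by_contra hG
    exact h ((SimpleGraph.compl_adj G a b).2 ⟨hab, hG⟩)
  refine ⟨k + 2, _, IndCyc.of_list (q := fun r => if r = k + 1 then v else q r)
    (by omega) ?_ ?_ ?_, ?_⟩
  · intro i hi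
    rw [if_neg (by omega)]
    split_ifs with h
    · rw [show i = k by omega]
      exact hk.symm
    · exact hq i (by omega)
  · rw [if_pos (by omega), if_neg (by omega)]
    exact h0
  · intro i j hij hj hor
    rw [if_neg (by omega)]
    split_ifs with h
    · have hvi : v ≠ q i := by
        rintro rfl
        exact hv (hqW i (by omega))
      exact (hGadj _ _ hvi (hinterior i (by omega) (by omega))).symm
    · exact hGadj _ _ (hdist i j (by omega) (by omega)) (hnadj i j hij (by omega))
  · have : ((Finset.range (k + 1)).image q).card = k + 1 := by
      rw [Finset.card_image_of_injOn, Finset.card_range]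
      intro a ha b hb hab
      simp only [Finset.coe_range, Set.mem_Iio] at ha hb
      rcases lt_trichotomy a b with hlt | heq | hlt
      · exact absurd hab (hdist a b hlt (by omega))
      · exact heq
      · exact absurd hab.symm (hdist b a hlt (by omega))
    have hle : ((Finset.range (k + 1)).image q).card ≤ W.card := by
      refine Finset.card_le_card (Finset.image_subset_iff.2 fun i hi => ?_)
      rw [Finset.mem_range] at hi
      exact hqW i (by omega)
    omega

end InducedCycles

section Cohomology

variable {K : Type} [Field K] {n : ℕ} {G : SimpleGraph (Fin n)}

theorem IsFace.subset {σ τ : Finset (Fin n)} (h : IsFace G σ) (hτ : τ ⊆ σ) : IsFace G τ :=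
  fun a ha b hb => h a (hτ ha) b (hτ hb)

theorem isFace_insert {v : Fin n} {τ : Finset (Fin n)} (h : IsFace G τ)
    (hv : ∀ a ∈ τ, ¬ G.Adj v a) : IsFace G (insert v τ) := by
  intro a ha b hb
  rw [Finset.mem_insert] at ha hb
  rcases ha with rfl | ha <;> rcases hb with rfl | hb
  · exact G.irrefl
  · exact hv b hb
  · exact fun hab => hv a ha hab.symm
  · exact h a ha b hb

theorem isFace_singleton (a : Fin n) : IsFace G {a} := by
  intro x hx y hy
  rw [Finset.mem_singleton] at hx hy
  subst hx hy
  exact G.irrefl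

theorem isFace_pair {a b : Fin n} (h : Gᶜ.Adj a b) : IsFace G {a, b} :=
  isFace_insert (isFace_singleton b) fun c hc => by
    rw [Finset.mem_singleton] at hc
    subst hc
    exact ((SimpleGraph.compl_adj G _ _).1 h).2

theorem insSign_insert_self (v : Fin n) {A : Finset (Fin n)} (hv : v ∉ A) :
    insSign v (insert v A) = insSign v A := by
  rw [insSign_insert _ _ _ hv, if_neg (lt_irrefl v), one_mul]

theorem insSign_singleton_self (v : Fin n) : insSign v {v} = 1 := by
  rw [insSign, Finset.filter_singleton, if_neg (lt_irrefl v), Finset.card_empty, pow_zero]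

theorem simplicialD_simplicialD (φ : Finset (Fin n) → K) (σ : Finset (Fin n)) :
    simplicialD (simplicialD φ) σ = 0 := by
  unfold simplicialD
  simp only [Finset.smul_sum]
  refine sum_erase_antisymm σ
    (fun v w => insSign v σ • insSign w (σ.erase v) • φ ((σ.erase v).erase w)) ?_
  intro u hu v hv huv
  obtain ⟨A, huA, hvA, rfl⟩ : ∃ A, u ∉ A ∧ v ∉ A ∧ σ = insert u (insert v A) :=
    ⟨(σ.erase u).erase v, by simp, by simp,
      by rw [Finset.insert_erase (Finset.mem_erase.2 ⟨huv.symm, hv⟩), Finset.insert_erase hu]⟩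
  have h1 : (insert u (insert v A)).erase u = insert v A :=
    Finset.erase_insert (by simp [huv, huA])
  have h2 : (insert u (insert v A)).erase v = insert u A := by
    rw [Finset.insert_comm, Finset.erase_insert (by simp [huv.symm, hvA])]
  rw [h1, h2, Finset.erase_insert huA, Finset.erase_insert hvA, smul_smul, smul_smul, ← neg_smul,
    insSign_insert_self u (by simp [huv, huA]), insSign_insert_self v hvA,
    insSign_insert_self u huA, Finset.insert_comm u v,
    insSign_insert_self v (by simp [huv.symm, hvA])]
  congr 1
  linarith [insSign_anticomm v u A hvA huA huv.symm]

theorem smul_simplicialD_insert (u : Finset (Fin n) → K) {v : Fin n} {τ : Finset (Fin n)}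
    (hv : v ∉ τ) :
    insSign v τ • simplicialD u (insert v τ) =
      u τ - simplicialD (fun ρ => insSign v ρ • u (insert v ρ)) τ := by
  unfold simplicialD
  rw [Finset.sum_insert hv, Finset.erase_insert hv, insSign_insert_self v hv, smul_add, smul_smul,
    insSign_mul_self, one_smul, sub_eq_add_neg, Finset.smul_sum, ← Finset.sum_neg_distrib]
  congr 1
  refine Finset.sum_congr rfl fun w hw => ?_
  have hwv : w ≠ v := fun h => hv (h ▸ hw)
  obtain ⟨A, hwA, rfl⟩ : ∃ A, w ∉ A ∧ τ = insert w A :=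
    ⟨τ.erase w, by simp, (Finset.insert_erase hw).symm⟩
  have hvA : v ∉ A := fun h => hv (Finset.mem_insert_of_mem h)
  rw [Finset.insert_comm, Finset.erase_insert (by simp [hwv, hwA]), Finset.erase_insert hwA,
    smul_smul, smul_smul, ← neg_smul, insSign_insert_self w hwA,
    insSign_insert_self w (by simp [hwv, hwA])]
  congr 1
  have h1 := insSign_anticomm w v A hwA hvA hwv
  have h2 := insSign_mul_self v A
  have h3 := insSign_mul_self v (insert w A)
  linear_combination insSign v (insert w A) * insSign v A * h1 -
    insSign v (insert w A) * insSign w (insert v A) * h2 - insSign w A * insSign v A * h3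

theorem simplicialD_pair (u : Finset (Fin n) → K) {a b : Fin n} (hab : a ≠ b) :
    simplicialD u {a, b} = 0 ↔ u {a} = u {b} := by
  have h := smul_simplicialD_insert u (v := a) (τ := {b}) (by simpa using hab)
  have h1 : simplicialD (fun ρ => insSign a ρ • u (insert a ρ)) {b} = u {a} := by
    rw [simplicialD, Finset.sum_singleton, insSign_singleton_self]
    simp [insSign]
  rw [h1] at h
  constructor
  · intro h0
    rw [h0, smul_zero] at h
    exact (sub_eq_zero.1 h.symm).symm
  · intro h0
    rw [h0, sub_self] at h
    have := congrArg (insSign a {b} • ·) h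
    simpa only [smul_smul, insSign_mul_self, one_smul, smul_zero] using this

end Cohomology

section Vanishing

variable {K : Type} [Field K] {n : ℕ} {G : SimpleGraph (Fin n)}

theorem simplicialD_sub (u w : Finset (Fin n) → K) (σ : Finset (Fin n)) :
    simplicialD (fun τ => u τ - w τ) σ = simplicialD u σ - simplicialD w σ := by
  simp only [simplicialD, smul_sub, Finset.sum_sub_distrib]

theorem simplicialD_add (u w : Finset (Fin n) → K) (σ : Finset (Fin n)) :
    simplicialD (fun τ => u τ + w τ) σ = simplicialD u σ + simplicialD w σ := by
  simp only [simplicialD, smul_add, Finset.sum_add_distrib]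

theorem simplicialD_congr {u w : Finset (Fin n) → K} {σ : Finset (Fin n)}
    (h : ∀ v ∈ σ, u (σ.erase v) = w (σ.erase v)) : simplicialD u σ = simplicialD w σ :=
  Finset.sum_congr rfl fun v hv => by rw [h v hv]

theorem simplicialD_eq_zero {u : Finset (Fin n) → K} {σ : Finset (Fin n)}
    (h : ∀ v ∈ σ, u (σ.erase v) = 0) : simplicialD u σ = 0 :=
  Finset.sum_eq_zero fun v hv => by rw [h v hv, smul_zero]

theorem insSign_smul_injective {v : Fin n} {σ : Finset (Fin n)} {x y : K}
    (h : insSign v σ • x = insSign v σ • y) : x = y := by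
  have := congrArg (insSign v σ • ·) h
  simpa only [smul_smul, insSign_mul_self, one_smul] using this

/-- It suffices to consider cocycles vanishing on the faces that avoid a vertex `v`. -/
theorem CohomVanish.of_erase {W : Finset (Fin n)} {v : Fin n} {m : ℕ}
    (h : CohomVanish K G (W.erase v) m)
    (hv : ∀ u : Finset (Fin n) → K,
      (∀ σ ⊆ W, IsFace G σ → σ.card = m + 1 → simplicialD u σ = 0) →
      (∀ σ ⊆ W.erase v, IsFace G σ → σ.card = m → u σ = 0) →
      ∃ φ : Finset (Fin n) → K, ∀ σ ⊆ W, IsFace G σ → σ.card = m → u σ = simplicialD φ σ) :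
    CohomVanish K G W m := by
  intro u hu
  obtain ⟨φ₀, hφ₀⟩ := h u fun σ hσ => hu σ (hσ.trans (Finset.erase_subset _ _))
  obtain ⟨φ, hφ⟩ := hv (fun σ => u σ - simplicialD φ₀ σ)
    (fun σ hσ hf hc => by
      rw [simplicialD_sub, hu σ hσ hf hc, simplicialD_simplicialD, sub_zero])
    (fun σ hσ hf hc => by rw [hφ₀ σ hσ hf hc, sub_self])
  refine ⟨fun σ => φ₀ σ + φ σ, fun σ hσ hf hc => ?_⟩
  rw [simplicialD_add, ← hφ σ hσ hf hc]
  ring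

/-- Passage from a cocycle that vanishes away from `v` to a cocycle on the link of `v`. -/
theorem simplicialD_link {W : Finset (Fin n)} {v : Fin n} (hvW : v ∈ W) {m : ℕ}
    {u : Finset (Fin n) → K}
    (hu : ∀ σ ⊆ W, IsFace G σ → σ.card = m + 1 → simplicialD u σ = 0)
    (hu0 : ∀ σ ⊆ W.erase v, IsFace G σ → σ.card = m → u σ = 0) {τ : Finset (Fin n)}
    (hτ : τ ⊆ W.erase v) (hf : IsFace G τ) (hadj : ∀ a ∈ τ, ¬ G.Adj v a) (hc : τ.card = m) :
    simplicialD (fun ρ => insSign v ρ • u (insert v ρ)) τ = 0 := by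
  have hvτ : v ∉ τ := fun h => Finset.notMem_erase v W (hτ h)
  have h := smul_simplicialD_insert u hvτ
  rw [hu _ (Finset.insert_subset hvW (hτ.trans (Finset.erase_subset _ _))) (isFace_insert hf hadj)
    (by rw [Finset.card_insert_of_notMem hvτ, hc]), hu0 τ hτ hf hc, smul_zero, zero_sub] at h
  exact neg_eq_zero.1 h.symm

theorem cohomVanish_succ_of_link {W : Finset (Fin n)} {v : Fin n} (hvW : v ∈ W) {m : ℕ}
    (h : CohomVanish K G (W.erase v) (m + 1))
    {L : Finset (Fin n)} (hL : ∀ a, a ∈ L ↔ a ∈ W.erase v ∧ Gᶜ.Adj v a)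
    (hlink : CohomVanish K G L m) :
    CohomVanish K G W (m + 1) := by
  classical
  refine h.of_erase fun u hu hu0 => ?_
  obtain ⟨φ', hφ'⟩ := hlink (fun ρ => insSign v ρ • u (insert v ρ)) fun τ hτ hf hc =>
    simplicialD_link hvW hu hu0 (fun a ha => ((hL a).1 (hτ ha)).1) hf
      (fun a ha => ((SimpleGraph.compl_adj G v a).1 ((hL a).1 (hτ ha)).2).2) hc
  refine ⟨fun σ => if v ∈ σ then -(insSign v (σ.erase v) • φ' (σ.erase v)) else 0,
    fun σ hσ hf hc => ?_⟩
  by_cases hvσ : v ∈ σ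
  · obtain ⟨τ, hvτ, rfl⟩ : ∃ τ, v ∉ τ ∧ σ = insert v τ :=
      ⟨σ.erase v, by simp, (Finset.insert_erase hvσ).symm⟩
    have hτW : τ ⊆ L := by
      intro a ha
      have hav : a ≠ v := fun h => hvτ (h ▸ ha)
      rw [hL, Finset.mem_erase, SimpleGraph.compl_adj]
      exact ⟨⟨hav, hσ (Finset.mem_insert_of_mem ha)⟩, hav.symm,
        hf v hvσ a (Finset.mem_insert_of_mem ha)⟩
    rw [Finset.card_insert_of_notMem hvτ] at hc
    have h1 := hφ' τ hτW (hf.subset (Finset.subset_insert _ _)) (by omega)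
    apply insSign_smul_injective (v := v) (σ := τ)
    rw [smul_simplicialD_insert _ hvτ, if_neg hvτ, h1, zero_sub, simplicialD, simplicialD,
      ← Finset.sum_neg_distrib]
    refine Finset.sum_congr rfl fun w _ => ?_
    have hvw : v ∉ τ.erase w := fun h => hvτ (Finset.mem_of_mem_erase h)
    rw [if_pos (Finset.mem_insert_self _ _), Finset.erase_insert hvw, smul_neg,
      smul_smul (insSign v _), insSign_mul_self, one_smul, smul_neg, neg_neg]
  · rw [hu0 σ (Finset.subset_erase.2 ⟨hσ, hvσ⟩) hf hc, simplicialD_eq_zero]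
    intro w hw
    rw [if_neg fun h => hvσ (Finset.mem_of_mem_erase h)]

theorem exists_pair_of_isFace {σ : Finset (Fin n)} (hf : IsFace G σ) (hc : σ.card = 2) :
    ∃ a b, Gᶜ.Adj a b ∧ σ = {a, b} := by
  obtain ⟨a, b, hab, rfl⟩ := Finset.card_eq_two.1 hc
  exact ⟨a, b, (SimpleGraph.compl_adj G a b).2 ⟨hab, hf a (by simp) b (by simp)⟩, rfl⟩

theorem cohomVanish_two_of_erase {W : Finset (Fin n)} {v : Fin n} (hvW : v ∈ W)
    (h : CohomVanish K G (W.erase v) 2) (hcyc : ∀ l p, IndCyc G l p → W.card < l) :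
    CohomVanish K G W 2 := by
  classical
  refine h.of_erase fun u hu hu0 => ?_
  let ψ : Fin n → K := fun a => insSign v {a} • u {v, a}
  have hψ : ∀ a b, a ∈ W.erase v → b ∈ W.erase v → Gᶜ.Adj v a → Gᶜ.Adj v b → Gᶜ.Adj a b →
      ψ a = ψ b := by
    intro a b ha hb hva hvb hab
    have := simplicialD_link hvW hu hu0 (τ := {a, b})
      (by simp [Finset.insert_subset_iff, ha, hb, -Finset.mem_erase]) (isFace_pair hab)
      (by
        intro c hc
        rw [Finset.mem_insert, Finset.mem_singleton] at hc
        rcases hc with rfl | rfl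
        · exact ((SimpleGraph.compl_adj G _ _).1 hva).2
        · exact ((SimpleGraph.compl_adj G _ _).1 hvb).2)
      (Finset.card_pair hab.ne)
    rwa [simplicialD_pair _ hab.ne] at this
  let H : SimpleGraph (Fin n) :=
    { Adj := fun a b => a ∈ W.erase v ∧ b ∈ W.erase v ∧ Gᶜ.Adj a b
      symm := ⟨fun a b hab => ⟨hab.2.1, hab.1, hab.2.2.symm⟩⟩
      loopless := ⟨fun a h => h.2.2.ne rfl⟩ }
  have hreach : ∀ a b, a ∈ W.erase v → b ∈ W.erase v → Gᶜ.Adj v a → Gᶜ.Adj v b →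
      H.Reachable a b → ψ a = ψ b := by
    rintro a b ha hb hva hvb ⟨w⟩
    by_contra hne
    have hwW : ∀ i ≤ w.length, w.getVert i ∈ W.erase v := by
      intro i hi
      rcases hi.lt_or_eq with hi | rfl
      · exact (w.adj_getVert_succ hi).1
      · rwa [w.getVert_length]
    obtain ⟨l, p, hp, hl⟩ := exists_indCyc_of_path (Finset.notMem_erase v W) hψ
      ⟨w.length, w.getVert, hwW, fun i hi => (w.adj_getVert_succ hi).2.2,
        by rwa [w.getVert_zero], by rwa [w.getVert_length],
        by rwa [w.getVert_zero, w.getVert_length]⟩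
    have := hcyc l p hp
    rw [Finset.card_erase_of_mem hvW] at hl
    have := Finset.card_pos.2 ⟨v, hvW⟩
    omega
  let Ψ : Fin n → K := fun a =>
    if h : ∃ b ∈ W.erase v, Gᶜ.Adj v b ∧ H.Reachable a b then ψ h.choose else 0
  have hΨ : ∀ a ∈ W.erase v, Gᶜ.Adj v a → Ψ a = ψ a := by
    intro a ha hva
    have h : ∃ b ∈ W.erase v, Gᶜ.Adj v b ∧ H.Reachable a b :=
      ⟨a, ha, hva, SimpleGraph.Reachable.refl a⟩
    obtain ⟨h1, h2, h3⟩ := h.choose_spec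
    simp only [Ψ, dif_pos h]
    exact (hreach _ _ ha h1 hva h2 h3).symm
  have hΨadj : ∀ a b, H.Adj a b → Ψ a = Ψ b := by
    intro a b hab
    have : ∀ c, H.Reachable a c ↔ H.Reachable b c := fun c =>
      ⟨fun h => hab.symm.reachable.trans h, fun h => hab.reachable.trans h⟩
    simp only [Ψ, this]
  let φ : Finset (Fin n) → K := fun σ => if v ∈ σ then 0 else ∑ a ∈ σ, Ψ a
  refine ⟨φ, fun σ hσ hf hc => ?_⟩
  by_cases hvσ : v ∈ σ
  · obtain ⟨a, ha⟩ := Finset.card_eq_one.1 (show (σ.erase v).card = 1 by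
      rw [Finset.card_erase_of_mem hvσ, hc])
    have haσ : a ∈ σ.erase v := ha ▸ Finset.mem_singleton_self a
    have hav : v ≠ a := (Finset.ne_of_mem_erase haσ).symm
    rw [← Finset.insert_erase hvσ, ha]
    apply insSign_smul_injective (v := v) (σ := {a})
    rw [smul_simplicialD_insert _ (by simpa using hav), simplicialD_eq_zero, sub_zero]
    · simp only [φ, Finset.mem_singleton, if_neg hav, Finset.sum_singleton]
      exact (hΨ a (Finset.erase_subset_erase v hσ haσ) ((SimpleGraph.compl_adj G _ _).2
        ⟨hav, hf v hvσ a (Finset.mem_of_mem_erase haσ)⟩)).symm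
    · intro w _
      simp only [φ, if_pos (Finset.mem_insert_self v _), smul_zero]
  · have hσ' := Finset.subset_erase.2 ⟨hσ, hvσ⟩
    rw [hu0 σ hσ' hf hc]
    obtain ⟨a, b, hab, rfl⟩ := exists_pair_of_isFace hf hc
    rw [eq_comm, simplicialD_pair _ hab.ne]
    simp only [Finset.mem_insert, Finset.mem_singleton, not_or] at hvσ
    simp only [φ, Finset.mem_singleton, if_neg hvσ.1, if_neg hvσ.2, Finset.sum_singleton]
    exact hΨadj a b ⟨hσ' (by simp), hσ' (by simp), hab⟩

/-- Vanishing of the cohomology of the independence complex in the absence of short induced cycles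
in the complement. -/
theorem cohomVanish_of_no_indCyc (W : Finset (Fin n)) (m : ℕ)
    (h : ∀ l p, IndCyc G l p → W.card < l + m) : CohomVanish K G W (m + 2) := by
  induction hN : W.card using Nat.strong_induction_on generalizing W m with
  | _ N ih =>
    subst hN
    rcases W.eq_empty_or_nonempty with rfl | ⟨v, hv⟩
    · refine fun u _ => ⟨0, fun σ hσ _ hc => ?_⟩
      rw [Finset.subset_empty.1 hσ] at hc
      simp at hc
    have hlt : (W.erase v).card < W.card := Finset.card_erase_lt_of_mem hv
    have h1 : CohomVanish K G (W.erase v) (m + 2) :=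
      ih _ hlt _ m (fun l p hp => by have := h l p hp; omega) rfl
    cases m with
    | zero => exact cohomVanish_two_of_erase hv h1 h
    | succ m =>
      classical
      obtain ⟨L, hL⟩ : ∃ L : Finset (Fin n), ∀ a, a ∈ L ↔ a ∈ W.erase v ∧ Gᶜ.Adj v a :=
        ⟨(W.erase v).filter fun a => Gᶜ.Adj v a, fun a => Finset.mem_filter⟩
      have hle : L.card ≤ (W.erase v).card := Finset.card_le_card fun a ha => ((hL a).1 ha).1
      exact cohomVanish_succ_of_link hv h1 hL
        (ih _ (by omega) _ m (fun l p hp => by have := h l p hp; omega) rfl)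

end Vanishing

section NonVanishing

variable {K : Type} [Field K] {n : ℕ} {G : SimpleGraph (Fin n)} {l : ℕ} {p : ℕ → Fin n}

/-- An induced cycle with an edge lying in no triangle of `W` carries nontrivial cohomology. -/
theorem IndCyc.not_cohomVanish_two (hp : IndCyc G l p) {W : Finset (Fin n)}
    (hW : IndCyc.verts l p ⊆ W)
    (h : ∀ x ∈ W, x ≠ p 0 → x ≠ p 1 → G.Adj (p 0) x ∨ G.Adj (p 1) x) :
    ¬ CohomVanish K G W 2 := by
  classical
  intro hc
  have hl := hp.four_le
  have h01 : Gᶜ.Adj (p 0) (p 1) := hp.adj_succ 0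
  obtain ⟨φ, hφ⟩ := hc (fun σ => if σ = {p 0, p 1} then 1 else 0) (by
    intro σ hσ hf hc
    refine simplicialD_eq_zero fun v hv => if_neg fun he => ?_
    have h0 : p 0 ∈ σ.erase v := by simp [he]
    have h1 : p 1 ∈ σ.erase v := by simp [he]
    rcases h v (hσ hv) (Finset.ne_of_mem_erase h0).symm (Finset.ne_of_mem_erase h1).symm
      with hadj | hadj
    · exact hf _ (Finset.mem_of_mem_erase h0) v hv hadj
    · exact hf _ (Finset.mem_of_mem_erase h1) v hv hadj)
  have hmem : ∀ k, p k ∈ W := fun k => hW (hp.mem_verts k)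
  have hpair : ∀ k, ({p k, p (k + 1)} : Finset (Fin n)) ⊆ W := fun k => by
    simp [Finset.insert_subset_iff, hmem]
  have hstep : ∀ k, 1 ≤ k → k < l → φ {p k} = φ {p (k + 1)} := by
    intro k hk hkl
    have hadj := hp.adj_succ k
    rw [← simplicialD_pair _ hadj.ne,
      ← hφ _ (hpair k) (isFace_pair hadj) (Finset.card_pair hadj.ne)]
    refine if_neg fun he => ?_
    have hk0 : p k ≠ p 0 := by
      have := hp.ne_add (k := 0) hk hkl
      rw [Nat.zero_add] at this
      exact this.symm
    have hk1 : p k = p 1 := by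
      have : p k ∈ ({p 0, p 1} : Finset (Fin n)) := by simp [← he]
      simpa [hk0] using this
    obtain rfl : k = 1 := by
      by_contra hne
      have := hp.ne_add (k := 1) (d := k - 1) (by omega) (by omega)
      rw [show 1 + (k - 1) = k by omega] at this
      exact this hk1.symm
    have h2 : p (1 + 1) ∈ ({p 0, p 1} : Finset (Fin n)) := by simp [← he]
    rw [Finset.mem_insert, Finset.mem_singleton] at h2
    rcases h2 with h2 | h2
    · exact hp.ne_add (k := 0) (d := 2) (by omega) (by omega) h2.symm
    · exact hadj.ne h2.symm
  have hconst : ∀ k, k < l → φ {p (k + 1)} = φ {p 1} := by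
    intro k hk
    induction k with
    | zero => rfl
    | succ k ih => rw [← hstep (k + 1) (by omega) hk, ih (by omega)]
  have hlast := hconst (l - 1) (by omega)
  rw [show l - 1 + 1 = 0 + l by omega, hp.periodic, ← simplicialD_pair _ h01.ne,
    ← hφ _ (hpair 0) (isFace_pair h01) (Finset.card_pair h01.ne)] at hlast
  simp at hlast

/-- Suspension: adjoining two nonadjacent vertices joined to all of `W` in the complement of `G`
shifts cohomology. -/
theorem cohomVanish_of_suspension {W : Finset (Fin n)} {a b : Fin n} {m : ℕ} (ha : a ∉ W)
    (hb : b ∉ W) (hab : G.Adj a b) (haW : ∀ x ∈ W, ¬ G.Adj a x) (hbW : ∀ x ∈ W, ¬ G.Adj b x)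
    (h : CohomVanish K G (insert a (insert b W)) (m + 1)) : CohomVanish K G W m := by
  classical
  intro u hu
  obtain ⟨φ, hφ⟩ := h
    (fun σ => if a ∈ σ then insSign a (σ.erase a) • u (σ.erase a) else 0) (by
      intro σ hσ hf hc
      by_cases haσ : a ∈ σ
      · obtain ⟨τ, haτ, rfl⟩ : ∃ τ, a ∉ τ ∧ σ = insert a τ :=
          ⟨σ.erase a, by simp, (Finset.insert_erase haσ).symm⟩
        rw [Finset.card_insert_of_notMem haτ] at hc
        have hτW : τ ⊆ W := by
          intro x hx
          have hxa : x ≠ a := fun h => haτ (h ▸ hx)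
          have hxb : x ≠ b := by
            rintro rfl
            exact hf a haσ x (Finset.mem_insert_of_mem hx) hab
          simpa [hxa, hxb] using hσ (Finset.mem_insert_of_mem hx)
        apply insSign_smul_injective (v := a) (σ := τ)
        rw [smul_simplicialD_insert _ haτ, if_neg haτ, smul_zero, zero_sub, neg_eq_zero]
        rw [← hu τ hτW (hf.subset (Finset.subset_insert _ _)) (by omega)]
        refine simplicialD_congr fun w _ => ?_
        have haw : a ∉ τ.erase w := fun h => haτ (Finset.mem_of_mem_erase h)
        rw [if_pos (Finset.mem_insert_self _ _), Finset.erase_insert haw, smul_smul,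
          insSign_mul_self, one_smul]
      · exact simplicialD_eq_zero fun w _ =>
          if_neg fun h => haσ (Finset.mem_of_mem_erase h))
  refine ⟨fun ρ => insSign b ρ • φ (insert b ρ) - insSign a ρ • φ (insert a ρ),
    fun τ hτ hf hc => ?_⟩
  have haτ : a ∉ τ := fun h => ha (hτ h)
  have hbτ : b ∉ τ := fun h => hb (hτ h)
  have hτ' : τ ⊆ insert a (insert b W) :=
    hτ.trans ((Finset.subset_insert _ _).trans (Finset.subset_insert _ _))
  have h1 := smul_simplicialD_insert φ haτ
  have h2 := smul_simplicialD_insert φ hbτ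
  rw [← hφ _ (Finset.insert_subset (by simp) hτ') (isFace_insert hf fun x hx => haW x (hτ hx))
    (by rw [Finset.card_insert_of_notMem haτ, hc]), if_pos (Finset.mem_insert_self _ _),
    Finset.erase_insert haτ, smul_smul, insSign_mul_self, one_smul] at h1
  rw [← hφ _ (Finset.insert_subset (by simp) hτ') (isFace_insert hf fun x hx => hbW x (hτ hx))
    (by rw [Finset.card_insert_of_notMem hbτ, hc]), if_neg (by simp [hab.ne, haτ]),
    smul_zero] at h2
  rw [simplicialD_sub, h1]
  linear_combination -h2

theorem cohomVanish_one {W : Finset (Fin n)}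
    (h : ∀ f : Fin n → K, (∀ a ∈ W, ∀ b ∈ W, Gᶜ.Adj a b → f a = f b) →
      ∀ a ∈ W, ∀ b ∈ W, f a = f b) : CohomVanish K G W 1 := by
  intro u hu
  have hconst := h (fun a => u {a}) fun a ha b hb hab => by
    have := hu {a, b} (by simp [Finset.insert_subset_iff, ha, hb]) (isFace_pair hab)
      (Finset.card_pair hab.ne)
    rwa [simplicialD_pair _ hab.ne] at this
  rcases W.eq_empty_or_nonempty with rfl | ⟨r, hr⟩
  · refine ⟨0, fun σ hσ _ hc => ?_⟩
    rw [Finset.subset_empty.1 hσ] at hc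
    simp at hc
  · refine ⟨fun _ => u {r}, fun σ hσ _ hc => ?_⟩
    obtain ⟨a, rfl⟩ := Finset.card_eq_one.1 hc
    rw [simplicialD, Finset.sum_singleton, insSign_singleton_self, one_smul]
    exact hconst a (hσ (Finset.mem_singleton_self a)) r hr

theorem IndCyc.cohomVanish_one (hp : IndCyc G l p)
    (hout : ∀ x ∉ IndCyc.verts l p, ∀ y, ¬ G.Adj x y) {W : Finset (Fin n)}
    (hW : W.card + 1 = l) : CohomVanish K G W 1 := by
  refine _root_.cohomVanish_one fun f hf => ?_
  by_cases hx : ∃ x ∈ W, x ∉ IndCyc.verts l p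
  · obtain ⟨x, hxW, hx⟩ := hx
    have key : ∀ a ∈ W, f a = f x := by
      intro a ha
      by_cases hax : x = a
      · rw [hax]
      · exact (hf x hxW a ha ((SimpleGraph.compl_adj G _ _).2 ⟨hax, hout x hx a⟩)).symm
    intro a ha b hb
    rw [key a ha, key b hb]
  · push Not at hx
    have hcard := hp.card_verts
    obtain ⟨y, hy, hyW⟩ : ∃ y ∈ IndCyc.verts l p, y ∉ W :=
      Finset.exists_mem_notMem_of_card_lt_card (by omega)
    obtain ⟨s, -, rfl⟩ := hp.exists_of_mem_verts hy 0
    rw [Nat.zero_add] at hy hyW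
    have hWeq : W = (IndCyc.verts l p).erase (p s) := by
      refine Finset.eq_of_subset_of_card_le (fun a ha =>
        Finset.mem_erase.2 ⟨fun h => hyW (h ▸ ha), hx a ha⟩) ?_
      rw [Finset.card_erase_of_mem hy]
      omega
    have hmem : ∀ d, 1 ≤ d → d < l → p (s + d) ∈ W := by
      intro d h1 h2
      rw [hWeq, Finset.mem_erase]
      exact ⟨(hp.ne_add h1 h2).symm, hp.mem_verts _⟩
    have key : ∀ d, 1 ≤ d → d < l → f (p (s + d)) = f (p (s + 1)) := by
      intro d h1
      induction d, h1 using Nat.le_induction with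
      | base => exact fun _ => rfl
      | succ d hd ih =>
        intro h2
        rw [← ih (by omega)]
        exact (hf _ (hmem d hd (by omega)) _ (hmem (d + 1) (by omega) h2)
          (hp.adj_succ (s + d))).symm
    have key' : ∀ a ∈ W, f a = f (p (s + 1)) := by
      intro a ha
      obtain ⟨d, hd, rfl⟩ := hp.exists_of_mem_verts (hx a ha) s
      refine key d (Nat.one_le_iff_ne_zero.2 ?_) hd
      rintro rfl
      exact hyW ha
    intro a ha b hb
    rw [key' a ha, key' b hb]

end NonVanishing

section Index

variable {K : Type} [Field K] {n : ℕ} {I : Ideal (SRing K n)}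

theorem stepsLinear.mono {d r r' : ℕ} (h : stepsLinear I d r) (hr : r' ≤ r) :
    stepsLinear I d r' := fun i hi => h i (hi.trans hr)

theorem stepsLinear_of_lt_idealIndex {d r : ℕ} (h : (r : ℕ∞) < idealIndex I d) :
    stepsLinear I d r := by
  obtain ⟨_, ⟨r', rfl, hr'⟩, hlt⟩ := lt_sSup_iff.1 h
  refine hr'.mono (Nat.lt_succ_iff.1 ?_)
  exact_mod_cast hlt

theorem not_stepsLinear_of_idealIndex_le {d r : ℕ} (h : idealIndex I d ≤ (r : ℕ∞)) :
    ¬ stepsLinear I d r := by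
  intro hr
  have : ((r : ℕ∞) + 1) ≤ r := (le_sSup ⟨r, rfl, hr⟩ : ((r : ℕ∞) + 1) ≤ idealIndex I d).trans h
  exact absurd (by exact_mod_cast this : r + 1 ≤ r) (by omega)

theorem exists_resolution_of_projDim_eq {t : ℕ} (h : projDim I = (t : ℕ∞)) :
    ∃ R : GradedPartialRes I ⊤, ∀ i, t < i → R.s i = 0 := by
  have hne : {x : ℕ∞ | ∃ m : ℕ, x = (m : ℕ∞) ∧
      ∃ R : GradedPartialRes I ⊤, ∀ i : ℕ, m < i → R.s i = 0}.Nonempty := by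
    by_contra hempty
    rw [projDim, Set.not_nonempty_iff_eq_empty.1 hempty, sInf_empty] at h
    exact ENat.natCast_ne_top t h.symm
  obtain ⟨m, hm, R, hR⟩ := csInf_mem hne
  have : m = t := by
    rw [projDim, hm] at h
    exact_mod_cast h
  exact ⟨R, this ▸ hR⟩

end Index

/-- **Lemma.** If the edge ideal `I` of a simple graph has
`index(I) = projdim(I) = t` (finite), then `β_{t,t+2}(I) = 0`. -/
theorem stmt7 (K : Type) [Field K] (n : ℕ) (G : SimpleGraph (Fin n))
    (I : Ideal (SRing K n)) (hI : I = edgeIdeal K G.Adj) (t : ℕ)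
    (hind : idealIndex I 2 = (t : ℕ∞)) (hpd : projDim I = (t : ℕ∞)) :
    gradedBetti I t (t+2) = 0 := by
  classical
  have hhom : ∀ p ∈ I, ∀ j, homogeneousComponent j p ∈ I := by
    rw [hI]
    exact homogeneousComponent_mem_edgeIdeal G
  have hcoeff : ∀ p ∈ I, coeff 0 p = 0 := by
    rw [hI]
    exact coeff_zero_of_mem_edgeIdeal G
  have hvan : ∀ i j, t < i → KoszulVanish (fun _ => 0) (idealSub I) (i + 1) j := by
    obtain ⟨R, hR⟩ := exists_resolution_of_projDim_eq hpd
    intro i j hi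
    refine R.koszulVanish (ENat.natCast_lt_top i) fun k => ?_
    exact absurd (k.2.trans_eq (hR i hi)) (Nat.not_lt_zero _)
  have hlin : ∀ i j, i < t → 2 < j →
      KoszulVanish (fun _ => 0) (idealSub I) (i + 1) (i + j) := fun i j hi hj =>
    koszulVanish_of_gradedBetti_eq_zero
      (stepsLinear_of_lt_idealIndex (r := i) (by rw [hind]; exact_mod_cast hi) i le_rfl j hj)
  obtain ⟨j, hj, hnot⟩ : ∃ j, 2 < j ∧
      ¬ KoszulVanish (fun _ => 0) (idealSub I) (t + 1) (t + j) := by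
    have h := not_stepsLinear_of_idealIndex_le hind.le
    simp only [stepsLinear, not_forall] at h
    obtain ⟨i, hi, j, hj, hne⟩ := h
    have hnot := fun hk => hne (gradedBetti_eq_zero_of_koszulVanish hhom hcoeff hk)
    rcases hi.lt_or_eq with hi | rfl
    · exact absurd (hlin i j hi hj) hnot
    · exact ⟨j, hj, hnot⟩
  subst hI
  have hcohom : ∀ {W : Finset (Fin n)} {i m : ℕ},
      KoszulVanish (fun _ => 0) (idealSub (edgeIdeal K G.Adj)) i (i + m) → W.card = i + m →
      CohomVanish K G W m := fun h hW => cohomVanish_of_koszulVanish h hW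
  obtain ⟨l, p, hp, hlt⟩ : ∃ l p, IndCyc G l p ∧ l ≤ t + 3 := by
    by_contra hcyc
    push Not at hcyc
    refine hnot ?_
    rw [show t + j = t + 1 + (j - 3 + 2) by omega]
    refine koszulVanish_of_cohomVanish fun W hW => cohomVanish_of_no_indCyc W _ fun l p hp => ?_
    have := hcyc l p hp
    omega
  have hl4 := hp.four_le
  have hcard := hp.card_verts
  have hC : ¬ CohomVanish K G (IndCyc.verts l p) 2 :=
    hp.not_cohomVanish_two subset_rfl fun x => hp.adj_of_mem_verts
  obtain rfl : l = t + 3 := by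
    by_contra hne
    refine hC (hcohom (i := l - 3 + 1) ?_ (by omega))
    have := hlin (l - 3) 3 (by omega) (by omega)
    rwa [show l - 3 + 1 + 2 = l - 3 + 3 by omega]
  have hjoin : ∀ x ∉ IndCyc.verts (t + 3) p, ∀ y ∈ IndCyc.verts (t + 3) p, ¬ G.Adj x y := by
    intro x hx y hy hxy
    obtain ⟨s, -, rfl⟩ := hp.exists_of_mem_verts hy 0
    rw [Nat.zero_add] at hxy
    have hps := hp.shift s
    have hverts : ∀ y, y ∈ IndCyc.verts (t + 3) p →
        y ∈ IndCyc.verts (t + 3) fun k => p (s + k) := by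
      intro y hy
      obtain ⟨d, -, rfl⟩ := hp.exists_of_mem_verts hy s
      exact hps.mem_verts d
    have hverts' : IndCyc.verts (t + 3) (fun k => p (s + k)) ⊆ IndCyc.verts (t + 3) p := by
      intro y hy
      obtain ⟨d, -, rfl⟩ := hps.exists_of_mem_verts hy 0
      exact hp.mem_verts _
    refine hps.not_cohomVanish_two (K := K) (W := insert x (IndCyc.verts (t + 3) p))
      (hverts'.trans (Finset.subset_insert _ _)) ?_
      (hcohom (i := t + 1 + 1) (hvan (t + 1) _ (by omega))
        (by rw [Finset.card_insert_of_notMem hx, hcard]))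
    intro z hz h0 h1
    rcases Finset.mem_insert.1 hz with rfl | hz
    · exact Or.inl hxy.symm
    · exact hps.adj_of_mem_verts (hverts z hz) h0 h1
  have hout : ∀ x ∉ IndCyc.verts (t + 3) p, ∀ y, ¬ G.Adj x y := by
    intro x hx y hxy
    by_cases hy : y ∈ IndCyc.verts (t + 3) p
    · exact hjoin x hx y hy hxy
    · refine hC (cohomVanish_of_suspension hx hy hxy (hjoin x hx) (hjoin y hy)
        (hcohom (i := t + 1 + 1) (hvan (t + 1) _ (by omega)) ?_))
      rw [Finset.card_insert_of_notMem (by simp [hxy.ne, hx]), Finset.card_insert_of_notMem hy,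
        hcard]
  refine gradedBetti_eq_zero_of_koszulVanish hhom hcoeff ?_
  exact koszulVanish_of_cohomVanish (i := t + 1) (m := 1) fun W hW =>
    hp.cohomVanish_one hout (by omega)

end
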